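/- (Atomic decomposition of dyadic H^p.) Let f ∈ S₀ and 0 < p ≤ 1. The following are equivalent, up to constants depending only on p: (i) ‖Sf‖_{L^p} ≤ C, where Sf(x) := (Σ_{P∈𝐏⁺} |Wf(P)|² χ_{I_P}(x)/|I_P|)^{1/2} is the dyadic Littlewood–Paley square function; (ii) ‖M̃f‖_{L^p} ≤ C, where M̃f(x) := sup_{dyadic I ∋ x} |[f]_I| is the cancellative dyadic maximal function; (iii) there is a collection 𝐈 of dyadic intervals, nonnegative numbers c_I and H^p atoms a_I on Tree(I) for I ∈ 𝐈, such that f = Σ_{I∈𝐈} c_I a_I and Σ_{I∈𝐈} c_I^p ≤ C^p. -/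

import Mathlib

open MeasureTheory Set

noncomputable section

namespace Dyadic

/-- A dyadic interval/lacunary tile: `I = [j·2^k, (j+1)·2^k)` with `-M ≤ k ≤ M`,
`I ⊆ [0, 2^M)`.  Lacunary tiles are in bijection with dyadic intervals, so we
identify the tile `P⁺(I) = I × [1/|I|, 2/|I|)` with the data of `I`. -/
structure Tile (M : ℕ) where
  j : ℤ
  k : ℤ
  hk_lb : -(M : ℤ) ≤ k
  hk_ub : k ≤ (M : ℤ)
  hj : 0 ≤ j
  hsub : ((j : ℝ) + 1) * 2 ^ k ≤ 2 ^ (M : ℤ)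

variable {M : ℕ}

/-- The side length `|I_P| = 2^k` of the spatial interval of the tile. -/
def Tile.len (P : Tile M) : ℝ := 2 ^ P.k

/-- The spatial interval `I_P` of the tile. -/
def Tile.ival (P : Tile M) : Set ℝ :=
  Ico ((P.j : ℝ) * 2 ^ P.k) (((P.j : ℝ) + 1) * 2 ^ P.k)

/-- The order `P ≤′ Q` on lacunary tiles: `I_P ⊆ I_Q`. -/
def Tile.le (P Q : Tile M) : Prop := P.ival ⊆ Q.ival

/-- A (lacunary) tree: a collection of tiles together with a top tile. -/
structure Tree (M : ℕ) where
  tiles : Set (Tile M)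
  top : Tile M
  top_mem : top ∈ tiles
  le_top : ∀ P ∈ tiles, P.le top

/-- `|I_T|`, the length of the spatial interval of the top of the tree. -/
def Tree.len (T : Tree M) : ℝ := T.top.len

/-- A collection of tiles is convex if `P₁ ≤′ P ≤′ P₂` with `P₁, P₂` in the
collection implies `P` is in the collection. -/
def IsConvex (PP : Set (Tile M)) : Prop :=
  ∀ P₁ ∈ PP, ∀ P₂ ∈ PP, ∀ P : Tile M, P₁.le P → P.le P₂ → P ∈ PP

/-- The size `‖a‖_{size(T)} = (1/|I_T|) Σ_{P ∈ T} a(P)` of `a` on a tree `T`. -/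
def treeSize (a : Tile M → ℝ) (T : Tree M) : ℝ :=
  (∑ᶠ P ∈ T.tiles, a P) / T.len

/-- The maximal size `‖a‖_{size*(PP)}`: the supremum of `‖a‖_{size(T)}` over all
convex trees `T ⊆ PP` (by convention `0` if there are none). -/
def maxSize (a : Tile M → ℝ) (PP : Set (Tile M)) : ℝ :=
  sSup (insert 0 {s : ℝ | ∃ T : Tree M, T.tiles ⊆ PP ∧ IsConvex T.tiles ∧ s = treeSize a T})

/-- The complete tree `Tree(P) = {Q : Q ≤′ P}`. -/
def cTree (P : Tile M) : Set (Tile M) := {Q : Tile M | Q.le P}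

/-- A tree `T` is complete with respect to `PP` if `T = Tree(P_T) ∩ PP`. -/
def Tree.IsCompleteIn (T : Tree M) (PP : Set (Tile M)) : Prop :=
  T.tiles = cTree T.top ∩ PP

/-- `QQ` is an `α`-packing of the tree `T`: `QQ ⊆ T` and `Σ_{P ∈ QQ} |I_P| ≤ α|I_T|`. -/
def IsPacking (α : ℝ) (QQ : Set (Tile M)) (T : Tree M) : Prop :=
  QQ ⊆ T.tiles ∧ (∑ᶠ P ∈ QQ, Tile.len P) ≤ α * T.len

/-- `QQ` is a uniform `α`-packing of the tree `T`:
`Σ_{P ∈ QQ, I_P ⊆ J} |I_P| ≤ α|J|` for every dyadic interval `J`. -/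
def IsUniformPacking (α : ℝ) (QQ : Set (Tile M)) (T : Tree M) : Prop :=
  QQ ⊆ T.tiles ∧
    ∀ J : Tile M, (∑ᶠ P ∈ {P ∈ QQ | P.ival ⊆ J.ival}, Tile.len P) ≤ α * J.len

/-- Left half of the spatial interval. -/
def Tile.left (P : Tile M) : Set ℝ :=
  Ico ((P.j : ℝ) * 2 ^ P.k) (((P.j : ℝ) + 1 / 2) * 2 ^ P.k)

/-- Right half of the spatial interval. -/
def Tile.right (P : Tile M) : Set ℝ :=
  Ico (((P.j : ℝ) + 1 / 2) * 2 ^ P.k) (((P.j : ℝ) + 1) * 2 ^ P.k)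

/-- The (mother) Haar wavelet `φ_P = |I_P|^{-1/2}(χ_{I_l} - χ_{I_r})`. -/
def Tile.haar (P : Tile M) : ℝ → ℝ := fun x =>
  (Real.sqrt P.len)⁻¹ * (P.left.indicator 1 x - P.right.indicator 1 x)

/-- The Haar (wavelet) coefficient `Wf(P) = ⟨f, φ_P⟩`. -/
def waveCoeff (f : ℝ → ℝ) (P : Tile M) : ℝ := ∫ x, f x * P.haar x

/-- The average `[f]_{I_P} = (1/|I_P|)∫_{I_P} f`. -/
def tileAvg (f : ℝ → ℝ) (P : Tile M) : ℝ := (∫ x in P.ival, f x) / P.len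

/-- The mean `‖f‖_{mean(P)} = (1/|I_P|)∫_{I_P} |f|`. -/
def tileMean (f : ℝ → ℝ) (P : Tile M) : ℝ := (∫ x in P.ival, |f x|) / P.len

/-- The maximal mean `‖f‖_{mean*(PP)} = sup_{P ∈ PP} ‖f‖_{mean(P)}`. -/
def maxMean (f : ℝ → ℝ) (PP : Set (Tile M)) : ℝ :=
  sSup (insert 0 (tileMean f '' PP))

/-- The dyadic BMO norm `‖f‖_{BMO} = ‖|Wf|²‖_{size*(PP⁺)}^{1/2}`. -/
def bmoNorm (M : ℕ) (f : ℝ → ℝ) : ℝ :=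
  Real.sqrt (maxSize (fun P : Tile M => waveCoeff f P ^ 2) univ)

/-- The grid interval `[j·2^{-M}, (j+1)·2^{-M})` at the finest scale. -/
def gridIval (M : ℕ) (j : ℤ) : Set ℝ :=
  Ico ((j : ℝ) * 2 ^ (-(M : ℤ))) (((j : ℝ) + 1) * 2 ^ (-(M : ℤ)))

/-- A dyadic test function: supported on `[0, 2^M)` and constant on every dyadic
interval of length `2^{-M}`. -/
def IsTestFun (M : ℕ) (f : ℝ → ℝ) : Prop :=
  (∀ x : ℝ, x ∉ Ico (0 : ℝ) (2 ^ (M : ℤ)) → f x = 0) ∧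
    ∀ j : ℤ, ∀ x ∈ gridIval M j, ∀ y ∈ gridIval M j, f x = f y

/-- The `L²` norm. -/
def l2Norm (f : ℝ → ℝ) : ℝ := Real.sqrt (∫ x, f x ^ 2)

/-- The `L^∞` norm (as a supremum of values; adequate for test functions). -/
def supNorm (f : ℝ → ℝ) : ℝ := ⨆ x : ℝ, |f x|

/-- The weak `L^r` quasinorm `sup_{λ>0} λ |{|h| ≥ λ}|^{1/r}`. -/
def weakNorm (r : ℝ) (h : ℝ → ℝ) : ℝ :=
  sSup {s : ℝ | ∃ l : ℝ, 0 < l ∧ s = l * (volume {x : ℝ | l ≤ |h x|}).toReal ^ (1 / r)}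

/-- The phase space projection `Π_T f = Σ_{P ∈ T} ⟨f, φ_P⟩ φ_P` onto a tree. -/
def treeProj (T : Tree M) (f : ℝ → ℝ) : ℝ → ℝ := fun x =>
  ∑ᶠ P ∈ T.tiles, waveCoeff f P * P.haar x

/-- The high-low paraproduct `π_hl(f,g) = Σ_P Wf(P) [g]_P φ_P`. -/
def paraHL (M : ℕ) (f g : ℝ → ℝ) : ℝ → ℝ := fun x =>
  ∑ᶠ P : Tile M, waveCoeff f P * tileAvg g P * P.haar x

/-- The low-high paraproduct `π_lh(f,g) = Σ_P [f]_P Wg(P) φ_P`. -/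
def paraLH (M : ℕ) (f g : ℝ → ℝ) : ℝ → ℝ := fun x =>
  ∑ᶠ P : Tile M, tileAvg f P * waveCoeff g P * P.haar x

/-- The high-high paraproduct `π_hh(f,g) = Σ_P Wf(P) Wg(P) χ_{I_P}/|I_P|`. -/
def paraHH (M : ℕ) (f g : ℝ → ℝ) : ℝ → ℝ := fun x =>
  ∑ᶠ P : Tile M, waveCoeff f P * waveCoeff g P * P.ival.indicator 1 x / P.len

/-- The constant function `1` on `[0, 2^M)`. -/
def oneFn (M : ℕ) : ℝ → ℝ := (Ico (0 : ℝ) (2 ^ (M : ℤ))).indicator 1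

/-- A perfect dyadic Calderón–Zygmund operator, recorded via its kernel `K` and
kernel constant `A₀`. -/
structure PDCZ (M : ℕ) where
  K : ℝ → ℝ → ℝ
  A₀ : ℝ
  hA₀ : 0 < A₀
  meas : Measurable (Function.uncurry K)
  bound : ∀ x y : ℝ, x ≠ y → |K x y| ≤ A₀ / |x - y|
  perfectX : ∀ I J : Tile M, Disjoint I.ival J.ival →
    ∀ x ∈ I.ival, ∀ x' ∈ I.ival, ∀ y ∈ J.ival, K x y = K x' y
  perfectY : ∀ I J : Tile M, Disjoint I.ival J.ival →
    ∀ x ∈ I.ival, ∀ x' ∈ I.ival, ∀ y ∈ J.ival, K y x = K y x'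
  diag : ∀ I : Tile M, I.k = -(M : ℤ) → ∀ x ∈ I.ival, ∀ y ∈ I.ival, K x y = 0
  corner₁ : ∀ x ∈ Ico (0 : ℝ) (2 ^ ((M : ℤ) - 1)),
    ∀ y ∈ Ico ((2 : ℝ) ^ ((M : ℤ) - 1)) (2 ^ (M : ℤ)), K x y = 0
  corner₂ : ∀ x ∈ Ico ((2 : ℝ) ^ ((M : ℤ) - 1)) (2 ^ (M : ℤ)),
    ∀ y ∈ Ico (0 : ℝ) (2 ^ ((M : ℤ) - 1)), K x y = 0

/-- `Tf(x) = ∫ K(x,y) f(y) dy`. -/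
def PDCZ.app (Op : PDCZ M) (f : ℝ → ℝ) : ℝ → ℝ := fun x => ∫ y, Op.K x y * f y

/-- The transpose `T*f(x) = ∫ K(y,x) f(y) dy`. -/
def PDCZ.appT (Op : PDCZ M) (f : ℝ → ℝ) : ℝ → ℝ := fun x => ∫ y, Op.K y x * f y

/-- Complex-valued Haar coefficient. -/
def waveCoeffC (b : ℝ → ℂ) (P : Tile M) : ℂ := ∫ x, b x * (P.haar x : ℂ)

/-- Complex-valued average. -/
def tileAvgC (b : ℝ → ℂ) (P : Tile M) : ℂ := (∫ x in P.ival, b x) / (P.len : ℂ)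

/-- BMO norm of a complex-valued function. -/
def bmoNormC (M : ℕ) (b : ℝ → ℂ) : ℝ :=
  Real.sqrt (maxSize (fun P : Tile M => ‖waveCoeffC b P‖ ^ 2) univ)

/-- Complex-valued dyadic test functions. -/
def IsTestFunC (M : ℕ) (b : ℝ → ℂ) : Prop :=
  (∀ x : ℝ, x ∉ Ico (0 : ℝ) (2 ^ (M : ℤ)) → b x = 0) ∧
    ∀ j : ℤ, ∀ x ∈ gridIval M j, ∀ y ∈ gridIval M j, b x = b y

/-- The operator applied to a complex-valued function. -/
def PDCZ.appC (Op : PDCZ M) (b : ℝ → ℂ) : ℝ → ℂ := fun x => ∫ y, (Op.K x y : ℂ) * b y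

/-- The dyadic Littlewood–Paley square function (its pointwise magnitude). -/
def squareFn (M : ℕ) (f : ℝ → ℝ) : ℝ → ℝ := fun x =>
  Real.sqrt (∑ᶠ P : Tile M, waveCoeff f P ^ 2 * P.ival.indicator 1 x / P.len)

/-- The cancellative dyadic maximal function `M̃f(x) = sup_{I ∋ x} |[f]_I|`. -/
def cancelMax (M : ℕ) (f : ℝ → ℝ) : ℝ → ℝ := fun x =>
  sSup {r : ℝ | ∃ P : Tile M, x ∈ P.ival ∧ r = |tileAvg f P|}

/-- A dyadic `H^p` atom on `Tree(I)`: `a ∈ S₀(I)` with `‖a‖₂ ≤ |I|^{1/2-1/p}`. -/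
def IsHpAtom (M : ℕ) (p : ℝ) (I : Tile M) (a : ℝ → ℝ) : Prop :=
  IsTestFun M a ∧ (∫ x, a x) = 0 ∧ (∀ x ∉ I.ival, a x = 0) ∧
    (∫ x, a x ^ 2) ≤ I.len ^ (1 - 2 / p)

/-- An atomic decomposition of `f` with `ℓ^p` coefficient bound `B`. -/
def HasAtomicDecomp (M : ℕ) (p : ℝ) (f : ℝ → ℝ) (B : ℝ) : Prop :=
  ∃ (II : Finset (Tile M)) (c : Tile M → ℝ) (g : Tile M → ℝ → ℝ),
    (∀ I ∈ II, 0 ≤ c I ∧ IsHpAtom M p I (g I)) ∧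
    (∀ x : ℝ, f x = ∑ I ∈ II, c I * g I x) ∧
    (∑ I ∈ II, c I ^ p) ≤ B ^ p




lemma two_zpow_pos (k : ℤ) : (0:ℝ) < 2 ^ k := by positivity

lemma mem_dI_iff (x : ℝ) (j k : ℤ) :
    x ∈ Ico ((j : ℝ) * 2 ^ k) (((j : ℝ) + 1) * 2 ^ k) ↔ ⌊x / 2 ^ k⌋ = j := by
  have h := two_zpow_pos k
  rw [Int.floor_eq_iff, le_div_iff₀ h, div_lt_iff₀ h, mem_Ico]

lemma mem_dI_coarse {x : ℝ} {j k j' k' : ℤ} (hk : k ≤ k')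
    (hx : x ∈ Ico ((j : ℝ) * 2 ^ k) (((j : ℝ) + 1) * 2 ^ k)) :
    x ∈ Ico ((j' : ℝ) * 2 ^ k') (((j' : ℝ) + 1) * 2 ^ k') ↔
      j / ((2 ^ (k' - k).toNat : ℕ) : ℤ) = j' := by
  rw [mem_dI_iff] at hx ⊢
  have : x / 2 ^ k' = (x / 2 ^ k) / ((2 ^ (k' - k).toNat : ℕ) : ℝ) := by
    have e : (2:ℝ) ^ k' = 2 ^ k * ((2 ^ (k' - k).toNat : ℕ) : ℝ) := by
      push_cast
      rw [← zpow_natCast, Int.toNat_of_nonneg (by omega), ← zpow_add₀ (by norm_num)]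
      congr 1; ring
    rw [e, div_div]
  rw [this, Int.floor_div_natCast, hx]

lemma Tile.ext' {P Q : Tile M} (hj : P.j = Q.j) (hk : P.k = Q.k) : P = Q := by
  cases P; cases Q; simp_all

lemma Tile.len_pos (P : Tile M) : 0 < P.len := two_zpow_pos _

lemma Tile.lo_lt (P : Tile M) : (P.j : ℝ) * 2 ^ P.k < ((P.j : ℝ) + 1) * 2 ^ P.k := by
  have := two_zpow_pos P.k
  nlinarith

lemma Tile.nonempty (P : Tile M) : P.ival.Nonempty := nonempty_Ico.2 P.lo_lt

lemma Tile.meas (P : Tile M) : MeasurableSet P.ival := measurableSet_Ico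

lemma Tile.vol (P : Tile M) : volume.real P.ival = P.len := by
  rw [Tile.ival, Real.volume_real_Ico_of_le P.lo_lt.le, Tile.len]; ring

lemma Tile.vol_ne_top (P : Tile M) : volume P.ival ≠ ⊤ := by
  simp [Tile.ival]

lemma Tile.le_rfl' (P : Tile M) : P.le P := Subset.rfl

lemma Tile.le_trans' {P Q R : Tile M} (h : P.le Q) (h' : Q.le R) : P.le R := Subset.trans h h'

/-- nestedness -/
lemma Tile.le_of_mem {P Q : Tile M} (hk : P.k ≤ Q.k) {x : ℝ} (hP : x ∈ P.ival) (hQ : x ∈ Q.ival) :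
    P.le Q := by
  intro y hy
  unfold Tile.ival at *
  rw [mem_dI_coarse hk hy, ← mem_dI_coarse hk hP]
  exact hQ

lemma Tile.k_le {P Q : Tile M} (h : P.le Q) : P.k ≤ Q.k := by
  have h1 := measureReal_mono h Q.vol_ne_top
  rw [P.vol, Q.vol] at h1
  exact (zpow_le_zpow_iff_right₀ (by norm_num)).1 h1

lemma Tile.eq_of_mem {P Q : Tile M} (hk : P.k = Q.k) {x : ℝ} (hP : x ∈ P.ival) (hQ : x ∈ Q.ival) :
    P = Q := by
  refine Tile.ext' ?_ hk
  unfold Tile.ival at *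
  rw [mem_dI_iff] at hP hQ
  rw [hk] at hP
  omega

lemma Tile.eq_of_le {P Q : Tile M} (h : P.le Q) (hk : Q.k ≤ P.k) : P = Q := by
  obtain ⟨x, hx⟩ := P.nonempty
  exact Tile.eq_of_mem (le_antisymm (Tile.k_le h) hk) hx (h hx)

lemma Tile.k_lt {P Q : Tile M} (h : P.le Q) (hne : P ≠ Q) : P.k < Q.k := by
  by_contra hc
  exact hne (Tile.eq_of_le h (by omega))

lemma Tile.trichotomy (P Q : Tile M) : P.le Q ∨ Q.le P ∨ Disjoint P.ival Q.ival := by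
  by_cases h : Disjoint P.ival Q.ival
  · exact Or.inr (Or.inr h)
  · obtain ⟨x, hx, hx'⟩ := Set.not_disjoint_iff.1 h
    rcases le_total P.k Q.k with hk | hk
    · exact Or.inl (Tile.le_of_mem hk hx hx')
    · exact Or.inr (Or.inl (Tile.le_of_mem hk hx' hx))

lemma grid_mem {j : ℤ} {x y : ℝ} (hx : x ∈ gridIval M j) (hy : y ∈ gridIval M j) (P : Tile M) :
    x ∈ P.ival ↔ y ∈ P.ival := by
  unfold gridIval at *
  unfold Tile.ival
  rw [mem_dI_coarse P.hk_lb hx, mem_dI_coarse P.hk_lb hy]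

instance : Finite (Tile M) := by
  have : Set.Finite (Icc (0:ℤ) (2 ^ (2 * M)) ×ˢ Icc (-(M:ℤ)) M) :=
    (finite_Icc _ _).prod (finite_Icc _ _)
  have := this.to_subtype
  refine Finite.of_injective
    (fun P : Tile M => (⟨(P.j, P.k), ?_⟩ : (Icc (0:ℤ) (2 ^ (2 * M)) ×ˢ Icc (-(M:ℤ)) M : Set (ℤ × ℤ)))) ?_
  · refine ⟨⟨P.hj, ?_⟩, P.hk_lb, P.hk_ub⟩
    have h1 := P.hsub
    have h2 : (2:ℝ) ^ (-(M:ℤ)) ≤ 2 ^ P.k := zpow_le_zpow_right₀ (by norm_num) P.hk_lb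
    have h0 : (0:ℝ) ≤ P.j := by exact_mod_cast P.hj
    have h3 : ((P.j : ℝ) + 1) * 2 ^ (-(M:ℤ)) ≤ 2 ^ (M:ℤ) :=
      le_trans (mul_le_mul_of_nonneg_left h2 (by linarith)) h1
    rw [zpow_neg, ← div_eq_mul_inv, div_le_iff₀ (two_zpow_pos _)] at h3
    have h4 : (P.j : ℝ) ≤ 2 ^ (2 * M) := by
      rw [two_mul, pow_add]
      simp only [zpow_natCast] at h3
      linarith
    show P.j ≤ _
    exact_mod_cast h4
  · intro P Q h
    have h1 := congrArg Subtype.val h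
    exact Tile.ext' (congrArg Prod.fst h1) (congrArg Prod.snd h1)

instance : Fintype (Tile M) := Fintype.ofFinite _

instance : DecidableEq (Tile M) := Classical.decEq _

/-- left child -/
def Tile.lc (P : Tile M) (h : -(M:ℤ) < P.k) : Tile M where
  j := 2 * P.j
  k := P.k - 1
  hk_lb := by omega
  hk_ub := by have := P.hk_ub; omega
  hj := by have := P.hj; omega
  hsub := by
    refine le_trans ?_ P.hsub
    rw [zpow_sub_one₀ (by norm_num)]
    have := two_zpow_pos P.k
    push_cast
    nlinarith

/-- right child -/
def Tile.rc (P : Tile M) (h : -(M:ℤ) < P.k) : Tile M where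
  j := 2 * P.j + 1
  k := P.k - 1
  hk_lb := by omega
  hk_ub := by have := P.hk_ub; omega
  hj := by have := P.hj; omega
  hsub := by
    refine le_trans ?_ P.hsub
    rw [zpow_sub_one₀ (by norm_num)]
    have := two_zpow_pos P.k
    push_cast
    nlinarith

lemma Tile.lc_ival (P : Tile M) (h : -(M:ℤ) < P.k) : (P.lc h).ival = P.left := by
  simp only [Tile.ival, Tile.left, Tile.lc]
  rw [zpow_sub_one₀ (by norm_num)]
  push_cast
  congr 1 <;> ring

lemma Tile.rc_ival (P : Tile M) (h : -(M:ℤ) < P.k) : (P.rc h).ival = P.right := by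
  simp only [Tile.ival, Tile.right, Tile.rc]
  rw [zpow_sub_one₀ (by norm_num)]
  push_cast
  congr 1 <;> ring

lemma Tile.lc_len (P : Tile M) (h : -(M:ℤ) < P.k) : (P.lc h).len = P.len / 2 := by
  simp only [Tile.len, Tile.lc]
  rw [zpow_sub_one₀ (by norm_num)]; rfl

lemma Tile.rc_len (P : Tile M) (h : -(M:ℤ) < P.k) : (P.rc h).len = P.len / 2 := by
  simp only [Tile.len, Tile.rc]
  rw [zpow_sub_one₀ (by norm_num)]; rfl

lemma Tile.union_lr (P : Tile M) : P.left ∪ P.right = P.ival := by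
  have := two_zpow_pos P.k
  exact Ico_union_Ico_eq_Ico (by nlinarith) (by nlinarith)

lemma Tile.disj_lr (P : Tile M) : Disjoint P.left P.right := by
  rw [Set.disjoint_left]
  rintro x ⟨_, h⟩ ⟨h', _⟩
  linarith

lemma Tile.meas_left (P : Tile M) : MeasurableSet P.left := measurableSet_Ico
lemma Tile.meas_right (P : Tile M) : MeasurableSet P.right := measurableSet_Ico

lemma Tile.left_sub (P : Tile M) : P.left ⊆ P.ival := P.union_lr ▸ subset_union_left
lemma Tile.right_sub (P : Tile M) : P.right ⊆ P.ival := P.union_lr ▸ subset_union_right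

lemma Tile.vol_left (P : Tile M) : volume.real P.left = P.len / 2 := by
  have := two_zpow_pos P.k
  rw [Tile.left, Real.volume_real_Ico_of_le (by nlinarith), Tile.len]; ring

lemma Tile.vol_right (P : Tile M) : volume.real P.right = P.len / 2 := by
  have := two_zpow_pos P.k
  rw [Tile.right, Real.volume_real_Ico_of_le (by nlinarith), Tile.len]; ring

lemma Tile.lc_le (P : Tile M) (h : -(M:ℤ) < P.k) : (P.lc h).le P := by
  rw [Tile.le, Tile.lc_ival]; exact P.left_sub
lemma Tile.rc_le (P : Tile M) (h : -(M:ℤ) < P.k) : (P.rc h).le P := by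
  rw [Tile.le, Tile.rc_ival]; exact P.right_sub

lemma Tile.le_child {Q P : Tile M} (h : -(M:ℤ) < P.k) (hle : Q.le P) (hne : Q ≠ P) :
    Q.le (P.lc h) ∨ Q.le (P.rc h) := by
  have hk := Tile.k_lt hle hne
  obtain ⟨x, hx⟩ := Q.nonempty
  have hxP := hle hx
  rw [← P.union_lr] at hxP
  rcases hxP with hl | hr
  · left
    rw [← P.lc_ival h] at hl
    exact Tile.le_of_mem (by show Q.k ≤ P.k - 1; omega) hx hl
  · right
    rw [← P.rc_ival h] at hr
    exact Tile.le_of_mem (by show Q.k ≤ P.k - 1; omega) hx hr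

theorem Tile.ind {motive : Tile M → Prop} (leaf : ∀ P : Tile M, P.k = -(M:ℤ) → motive P)
    (step : ∀ (P : Tile M) (h : -(M:ℤ) < P.k), motive (P.lc h) → motive (P.rc h) → motive P)
    (P : Tile M) : motive P := by
  have : ∀ n : ℕ, ∀ P : Tile M, P.k = -(M:ℤ) + n → motive P := by
    intro n
    induction n with
    | zero => intro P hP; exact leaf P (by simpa using hP)
    | succ n ih =>
      intro P hP
      push_cast at hP
      have h : -(M:ℤ) < P.k := by omega
      exact step P h (ih _ (by show P.k - 1 = _; omega)) (ih _ (by show P.k - 1 = _; omega))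
  have hl := P.hk_lb
  exact this (P.k + M).toNat P (by omega)

/-- the finset of subtiles -/
def Tile.sub (P : Tile M) : Finset (Tile M) := by
  classical exact Finset.univ.filter (fun Q => Q.le P)

@[simp] lemma Tile.mem_sub {P Q : Tile M} : Q ∈ P.sub ↔ Q.le P := by simp [Tile.sub]

lemma Tile.sum_sub_leaf (P : Tile M) (h : P.k = -(M:ℤ)) (g : Tile M → ℝ) :
    ∑ Q ∈ P.sub, g Q = g P := by
  have : P.sub = {P} := by
    ext Q
    simp only [Tile.mem_sub, Finset.mem_singleton]
    constructor
    · intro hQ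
      exact Tile.eq_of_le hQ (by rw [h]; exact Q.hk_lb)
    · rintro rfl; exact Tile.le_rfl' _
  rw [this, Finset.sum_singleton]

lemma Tile.sum_sub_step (P : Tile M) (h : -(M:ℤ) < P.k) (g : Tile M → ℝ) :
    ∑ Q ∈ P.sub, g Q = g P + ∑ Q ∈ (P.lc h).sub, g Q + ∑ Q ∈ (P.rc h).sub, g Q := by
  have hd : Disjoint (P.lc h).sub (P.rc h).sub := by
    rw [Finset.disjoint_left]
    intro Q h1 h2
    rw [Tile.mem_sub] at h1 h2
    obtain ⟨x, hx⟩ := Q.nonempty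
    have a := h1 hx
    have b := h2 hx
    rw [Tile.lc_ival] at a
    rw [Tile.rc_ival] at b
    exact Set.disjoint_left.1 P.disj_lr a b
  have hn : P ∉ (P.lc h).sub ∪ (P.rc h).sub := by
    simp only [Finset.mem_union, Tile.mem_sub]
    rintro (h1 | h1)
    · have : P.k ≤ P.k - 1 := Tile.k_le h1
      omega
    · have : P.k ≤ P.k - 1 := Tile.k_le h1
      omega
  have : P.sub = insert P ((P.lc h).sub ∪ (P.rc h).sub) := by
    ext Q
    simp only [Finset.mem_insert, Finset.mem_union, Tile.mem_sub]
    constructor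
    · intro hQ
      by_cases e : Q = P
      · exact Or.inl e
      · exact Or.inr (Tile.le_child h hQ e)
    · rintro (rfl | h1 | h1)
      · exact Tile.le_rfl' _
      · exact Tile.le_trans' h1 (P.lc_le h)
      · exact Tile.le_trans' h1 (P.rc_le h)
  rw [this, Finset.sum_insert hn, Finset.sum_union hd, ← _root_.add_assoc]

/-- the root tile -/
def root (M : ℕ) : Tile M where
  j := 0
  k := M
  hk_lb := by omega
  hk_ub := le_rfl
  hj := le_rfl
  hsub := by simp

lemma root_ival : (root M).ival = Ico (0:ℝ) (2 ^ (M:ℤ)) := by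
  simp [root, Tile.ival]

lemma le_root (P : Tile M) : P.le (root M) := by
  rw [Tile.le, root_ival]
  refine Ico_subset_Ico ?_ P.hsub
  have : (0:ℝ) ≤ P.j := by exact_mod_cast P.hj
  have := two_zpow_pos P.k
  positivity

lemma sub_root : (root M).sub = Finset.univ := by
  ext Q; simp [le_root]



lemma leaf_const {f : ℝ → ℝ} (hf : IsTestFun M f) {P : Tile M} (h : P.k = -(M:ℤ)) {x y : ℝ}
    (hx : x ∈ P.ival) (hy : y ∈ P.ival) : f x = f y := by
  have e : P.ival = gridIval M P.j := by simp only [Tile.ival, gridIval, h]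
  rw [e] at hx hy
  exact hf.2 P.j x hx y hy

lemma integrableOn_split {P : Tile M} {f : ℝ → ℝ} (h : -(M:ℤ) < P.k)
    (h1 : IntegrableOn f (P.lc h).ival) (h2 : IntegrableOn f (P.rc h).ival) :
    IntegrableOn f P.ival := by
  rw [← P.union_lr, ← P.lc_ival h, ← P.rc_ival h]
  exact h1.union h2

lemma IsTestFun.integrable {f : ℝ → ℝ} (hf : IsTestFun M f) : Integrable f := by
  have h : ∀ P : Tile M, IntegrableOn f P.ival := by
    intro P
    induction P using Tile.ind with
    | leaf P h =>
      obtain ⟨x, hx⟩ := P.nonempty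
      have : IntegrableOn (fun _ : ℝ => f x) P.ival :=
        integrableOn_const P.vol_ne_top
      exact this.congr_fun (fun y hy => leaf_const hf h hx hy) P.meas
    | step P h h1 h2 => exact integrableOn_split h h1 h2
  have h0 := h (root M)
  rw [root_ival] at h0
  rw [← integrableOn_iff_integrable_of_support_subset (s := Ico (0:ℝ) (2 ^ (M:ℤ)))]
  · exact h0
  · intro x hx
    by_contra hc
    exact hx (hf.1 x hc)

lemma IsTestFun.comp {f : ℝ → ℝ} (hf : IsTestFun M f) (g : ℝ → ℝ) (hg : g 0 = 0) :
    IsTestFun M (fun x => g (f x)) :=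
  ⟨fun x hx => by simp [hf.1 x hx, hg], fun j x hx y hy => by simp [hf.2 j x hx y hy]⟩

lemma IsTestFun.sum {ι : Type*} (s : Finset ι) (f : ι → ℝ → ℝ) (hf : ∀ i ∈ s, IsTestFun M (f i)) :
    IsTestFun M (fun x => ∑ i ∈ s, f i x) :=
  ⟨fun x hx => Finset.sum_eq_zero fun i hi => (hf i hi).1 x hx,
    fun j x hx y hy => Finset.sum_congr rfl fun i hi => (hf i hi).2 j x hx y hy⟩

lemma haar_left {P : Tile M} {x : ℝ} (hx : x ∈ P.left) : P.haar x = (Real.sqrt P.len)⁻¹ := by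
  have : x ∉ P.right := Set.disjoint_left.1 P.disj_lr hx
  simp [Tile.haar, hx, this]

lemma haar_right {P : Tile M} {x : ℝ} (hx : x ∈ P.right) : P.haar x = -(Real.sqrt P.len)⁻¹ := by
  have : x ∉ P.left := Set.disjoint_right.1 P.disj_lr hx
  simp [Tile.haar, hx, this]

lemma haar_out {P : Tile M} {x : ℝ} (hx : x ∉ P.ival) : P.haar x = 0 := by
  have h1 : x ∉ P.right := fun h => hx (P.right_sub h)
  have h2 : x ∉ P.left := fun h => hx (P.left_sub h)
  simp [Tile.haar, h1, h2]

lemma haar_test {P : Tile M} (h : -(M:ℤ) < P.k) : IsTestFun M P.haar := by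
  constructor
  · intro x hx
    refine haar_out fun h' => hx ?_
    have := le_root P h'
    rwa [root_ival] at this
  · intro j x hx y hy
    have h1 := grid_mem hx hy (P.lc h)
    have h2 := grid_mem hx hy (P.rc h)
    rw [Tile.lc_ival] at h1
    rw [Tile.rc_ival] at h2
    by_cases a : y ∈ P.left <;> by_cases b : y ∈ P.right <;>
      simp [Tile.haar, Set.indicator, h1, h2, a, b]

lemma haar_meas (P : Tile M) : Measurable P.haar := by
  unfold Tile.haar
  exact ((measurable_one.indicator P.meas_left).sub (measurable_one.indicator P.meas_right)).const_mul _

lemma haar_bdd (P : Tile M) (x : ℝ) : ‖P.haar x‖ ≤ (Real.sqrt P.len)⁻¹ := by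
  have h0 : 0 ≤ (Real.sqrt P.len)⁻¹ := by positivity
  by_cases h : x ∈ P.ival
  · rw [← P.union_lr] at h
    rcases h with h | h
    · rw [haar_left h, Real.norm_of_nonneg h0]
    · rw [haar_right h, norm_neg, Real.norm_of_nonneg h0]
  · rw [haar_out h]; simp

lemma haar_integrable (P : Tile M) : Integrable P.haar := by
  rw [← integrableOn_iff_integrable_of_support_subset (s := P.ival)]
  · exact Measure.integrableOn_of_bounded P.vol_ne_top (haar_meas P).aestronglyMeasurable
      (Filter.Eventually.of_forall (haar_bdd P))
  · intro x hx
    by_contra hc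
    exact hx (haar_out hc)

lemma haar_mul_integrable (P : Tile M) {f : ℝ → ℝ} (hf : Integrable f) :
    Integrable (fun x => f x * P.haar x) :=
  hf.mul_bdd (haar_meas P).aestronglyMeasurable (Filter.Eventually.of_forall (haar_bdd P))

lemma waveCoeff_eq {f : ℝ → ℝ} (hf : Integrable f) (P : Tile M) :
    waveCoeff f P = (Real.sqrt P.len)⁻¹ * ((∫ x in P.left, f x) - ∫ x in P.right, f x) := by
  have : ∀ x, f x * P.haar x =
      (Real.sqrt P.len)⁻¹ * (P.left.indicator f x - P.right.indicator f x) := by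
    intro x
    simp only [Tile.haar, Set.indicator, Pi.one_apply]
    split_ifs <;> ring
  unfold waveCoeff
  simp_rw [this]
  rw [integral_const_mul, integral_sub (hf.indicator P.meas_left) (hf.indicator P.meas_right),
    integral_indicator P.meas_left, integral_indicator P.meas_right]

lemma setInt_split {f : ℝ → ℝ} {P : Tile M} (hf : IntegrableOn f P.ival) :
    ∫ x in P.ival, f x = (∫ x in P.left, f x) + ∫ x in P.right, f x := by
  rw [← P.union_lr, setIntegral_union P.disj_lr P.meas_right (hf.mono_set P.left_sub)
    (hf.mono_set P.right_sub)]

lemma setInt_const {f : ℝ → ℝ} {S : Set ℝ} (hS : MeasurableSet S) {c : ℝ} (h : ∀ x ∈ S, f x = c) :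
    ∫ x in S, f x = volume.real S * c := by
  rw [setIntegral_congr_fun hS (g := fun _ => c) (fun x hx => h x hx), setIntegral_const, smul_eq_mul]

lemma sqrt_len_sq (P : Tile M) : (Real.sqrt P.len)⁻¹ ^ 2 = P.len⁻¹ := by
  rw [inv_pow, Real.sq_sqrt P.len_pos.le]

lemma haar_const_on {P Q : Tile M} (hle : P.le Q) (hne : P ≠ Q) :
    ∃ c, ∀ x ∈ P.ival, Q.haar x = c := by
  have h : -(M:ℤ) < Q.k := lt_of_le_of_lt P.hk_lb (Tile.k_lt hle hne)
  rcases Tile.le_child h hle hne with h1 | h1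
  · refine ⟨(Real.sqrt Q.len)⁻¹, fun x hx => haar_left ?_⟩
    rw [← Q.lc_ival h]; exact h1 hx
  · refine ⟨-(Real.sqrt Q.len)⁻¹, fun x hx => haar_right ?_⟩
    rw [← Q.rc_ival h]; exact h1 hx

lemma wave_haar_lt {P Q : Tile M} (hle : P.le Q) (hne : P ≠ Q) : ∫ x, Q.haar x * P.haar x = 0 := by
  obtain ⟨c, hc⟩ := haar_const_on hle hne
  have := waveCoeff_eq (haar_integrable Q) P
  unfold waveCoeff at this
  rw [this, setInt_const P.meas_left (fun x hx => hc x (P.left_sub hx)),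
    setInt_const P.meas_right (fun x hx => hc x (P.right_sub hx)), P.vol_left, P.vol_right]
  ring

lemma haar_orth (P Q : Tile M) : ∫ x, P.haar x * Q.haar x = if P = Q then 1 else 0 := by
  split_ifs with h
  · subst h
    have := waveCoeff_eq (haar_integrable P) P
    unfold waveCoeff at this
    rw [this, setInt_const P.meas_left (fun x hx => haar_left hx),
      setInt_const P.meas_right (fun x hx => haar_right hx), P.vol_left, P.vol_right]
    have h1 := sqrt_len_sq P
    have h2 := P.len_pos
    calc _ = (Real.sqrt P.len)⁻¹ ^ 2 * P.len := by ring
      _ = 1 := by rw [h1]; exact inv_mul_cancel₀ h2.ne'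
  · rcases P.trichotomy Q with h1 | h1 | h1
    · simp_rw [_root_.mul_comm (P.haar _)]
      exact wave_haar_lt h1 h
    · exact wave_haar_lt h1 (Ne.symm h)
    · have : ∀ x, P.haar x * Q.haar x = 0 := by
        intro x
        by_cases hx : x ∈ P.ival
        · rw [haar_out (Set.disjoint_left.1 h1 hx), mul_zero]
        · rw [haar_out hx, zero_mul]
      simp [this]

lemma haar_norm (F : Finset (Tile M)) (b : Tile M → ℝ) :
    ∫ x, (∑ P ∈ F, b P * P.haar x) ^ 2 = ∑ P ∈ F, b P ^ 2 := by
  have e : ∀ x, (∑ P ∈ F, b P * P.haar x) ^ 2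
      = ∑ P ∈ F, ∑ Q ∈ F, (b P * b Q) * (P.haar x * Q.haar x) := by
    intro x
    rw [sq, Finset.sum_mul_sum]
    exact Finset.sum_congr rfl fun P _ => Finset.sum_congr rfl fun Q _ => by ring
  simp_rw [e]
  have hi : ∀ P Q : Tile M, Integrable (fun x => (b P * b Q) * (P.haar x * Q.haar x)) :=
    fun P Q => (haar_mul_integrable Q (haar_integrable P)).const_mul _
  rw [integral_finsetSum _ (fun P _ => integrable_finsetSum _ fun Q _ => hi P Q)]
  refine Finset.sum_congr rfl fun P hP => ?_
  rw [integral_finsetSum _ (fun Q _ => hi P Q)]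
  simp_rw [integral_const_mul, haar_orth]
  simp [hP, sq]

lemma haar_int (P : Tile M) : ∫ x, P.haar x = 0 := by
  rw [← setIntegral_eq_integral_of_forall_compl_eq_zero (s := P.ival) (fun x hx => haar_out hx),
    setInt_split (haar_integrable P).integrableOn,
    setInt_const P.meas_left (fun x hx => haar_left hx),
      setInt_const P.meas_right (fun x hx => haar_right hx), P.vol_left, P.vol_right]
  ring

lemma tileAvg_lc (f : ℝ → ℝ) (P : Tile M) (h : -(M:ℤ) < P.k) :
    tileAvg f (P.lc h) = 2 * (∫ x in P.left, f x) / P.len := by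
  unfold tileAvg
  rw [P.lc_ival, P.lc_len]
  have := P.len_pos
  field_simp

lemma tileAvg_rc (f : ℝ → ℝ) (P : Tile M) (h : -(M:ℤ) < P.k) :
    tileAvg f (P.rc h) = 2 * (∫ x in P.right, f x) / P.len := by
  unfold tileAvg
  rw [P.rc_ival, P.rc_len]
  have := P.len_pos
  field_simp

lemma wave_sq {f : ℝ → ℝ} (hf : Integrable f) (P : Tile M) (h : -(M:ℤ) < P.k) :
    waveCoeff f P ^ 2 + P.len * tileAvg f P ^ 2 =
      P.len / 2 * tileAvg f (P.lc h) ^ 2 + P.len / 2 * tileAvg f (P.rc h) ^ 2 := by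
  rw [tileAvg_lc, tileAvg_rc, waveCoeff_eq hf, mul_pow, sqrt_len_sq, tileAvg,
    setInt_split hf.integrableOn]
  have := P.len_pos
  field_simp
  ring

lemma tileAvg_mid {f : ℝ → ℝ} (hf : Integrable f) (P : Tile M) (h : -(M:ℤ) < P.k) :
    tileAvg f P = (tileAvg f (P.lc h) + tileAvg f (P.rc h)) / 2 := by
  rw [tileAvg_lc, tileAvg_rc, tileAvg, setInt_split hf.integrableOn]
  have := P.len_pos
  field_simp

lemma wave_leaf {f : ℝ → ℝ} (hf : IsTestFun M f) (P : Tile M) (h : P.k = -(M:ℤ)) :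
    waveCoeff f P = 0 := by
  obtain ⟨y, hy⟩ := P.nonempty
  have hc : ∀ x ∈ P.ival, f x = f y := fun x hx => leaf_const hf h hx hy
  rw [waveCoeff_eq hf.integrable, setInt_const P.meas_left (fun x hx => hc x (P.left_sub hx)),
    setInt_const P.meas_right (fun x hx => hc x (P.right_sub hx)), P.vol_left, P.vol_right]
  ring

lemma avg_leaf {f : ℝ → ℝ} (hf : IsTestFun M f) (P : Tile M) (h : P.k = -(M:ℤ)) {x : ℝ}
    (hx : x ∈ P.ival) : tileAvg f P = f x := by
  have hc : ∀ y ∈ P.ival, f y = f x := fun y hy => leaf_const hf h hy hx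
  rw [tileAvg, setInt_const P.meas hc, P.vol]
  have := P.len_pos
  field_simp

lemma haar_expand {f : ℝ → ℝ} (hf : IsTestFun M f) (Q : Tile M) :
    ∀ x ∈ Q.ival, f x = tileAvg f Q + ∑ P ∈ Q.sub, waveCoeff f P * P.haar x := by
  induction Q using Tile.ind with
  | leaf Q h =>
    intro x hx
    rw [Q.sum_sub_leaf h, wave_leaf hf Q h, avg_leaf hf Q h hx]; ring
  | step Q h hl hr =>
    intro x hx
    rw [Q.sum_sub_step h, tileAvg_mid hf.integrable Q h]
    have hL := Q.len_pos
    have h1 := sqrt_len_sq Q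
    have key : (Real.sqrt Q.len)⁻¹ * ((∫ x in Q.left, f x) - ∫ x in Q.right, f x) *
        (Real.sqrt Q.len)⁻¹ = (tileAvg f (Q.lc h) - tileAvg f (Q.rc h)) / 2 := by
      rw [tileAvg_lc, tileAvg_rc]
      calc _ = (Real.sqrt Q.len)⁻¹ ^ 2 * ((∫ x in Q.left, f x) - ∫ x in Q.right, f x) := by ring
        _ = _ := by rw [h1]; field_simp
    rw [waveCoeff_eq hf.integrable]
    rw [← Q.union_lr] at hx
    rcases hx with hx | hx
    · have hz : ∑ P ∈ (Q.rc h).sub, waveCoeff f P * P.haar x = 0 := by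
        refine Finset.sum_eq_zero fun P hP => ?_
        rw [Tile.mem_sub, Tile.le, Tile.rc_ival] at hP
        rw [haar_out (fun hc => Set.disjoint_left.1 Q.disj_lr hx (hP hc)), mul_zero]
      rw [hz, haar_left hx, key]
      have := hl x (by rwa [Tile.lc_ival])
      linarith
    · have hz : ∑ P ∈ (Q.lc h).sub, waveCoeff f P * P.haar x = 0 := by
        refine Finset.sum_eq_zero fun P hP => ?_
        rw [Tile.mem_sub, Tile.le, Tile.lc_ival] at hP
        rw [haar_out (fun hc => Set.disjoint_left.1 Q.disj_lr (hP hc) hx), mul_zero]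
      rw [hz, haar_right hx, mul_neg, key]
      have := hr x (by rwa [Tile.rc_ival])
      linarith

lemma haar_full {f : ℝ → ℝ} (hf : IsTestFun M f) (h0 : ∫ x, f x = 0) (x : ℝ) :
    f x = ∑ P : Tile M, waveCoeff f P * P.haar x := by
  by_cases hx : x ∈ (root M).ival
  · rw [haar_expand hf (root M) x hx, sub_root, tileAvg,
      setIntegral_eq_integral_of_forall_compl_eq_zero, h0]
    · simp
    · intro y hy
      rw [root_ival] at hy
      exact hf.1 y hy
  · rw [hf.1 x (by rwa [root_ival] at hx)]
    symm
    refine Finset.sum_eq_zero fun P _ => ?_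
    rw [haar_out (fun hc => hx (le_root P hc)), mul_zero]

lemma parseval {f : ℝ → ℝ} (hf : IsTestFun M f) (h0 : ∫ x, f x = 0) :
    ∫ x, f x ^ 2 = ∑ P : Tile M, waveCoeff f P ^ 2 := by
  rw [← haar_norm]
  congr 1
  ext x
  rw [haar_full hf h0 x]



lemma rpow_crude {p y t : ℝ} (hp0 : 0 < p) (hp1 : p ≤ 1) (hy : 0 ≤ y) (ht : 0 < t) :
    y ^ p ≤ t ^ p + t ^ (p - 2) * y ^ 2 := by
  have h1 : 0 ≤ t ^ (p - 2) * y ^ 2 := by positivity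
  have h2 : 0 ≤ t ^ p := by positivity
  rcases le_or_gt y t with h | h
  · have := Real.rpow_le_rpow hy h hp0.le
    linarith
  · have hy' : 0 < y := ht.trans h
    have e : y ^ p = y ^ (p - 2) * y ^ 2 := by
      rw [← Real.rpow_natCast, ← Real.rpow_add hy']; congr 1; push_cast; ring
    have := Real.rpow_le_rpow_of_nonpos ht h.le (by linarith : p - 2 ≤ 0)
    have := mul_le_mul_of_nonneg_right this (sq_nonneg y)
    linarith

lemma IsTestFun.rpow {f : ℝ → ℝ} (hf : IsTestFun M f) {p : ℝ} (hp : 0 < p) :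
    IsTestFun M (fun x => f x ^ p) := hf.comp (fun y => y ^ p) (Real.zero_rpow hp.ne')

lemma local_Lp {p : ℝ} (hp0 : 0 < p) (hp1 : p ≤ 1) (I : Tile M) {h G : ℝ → ℝ} (hh : IsTestFun M h)
    (h0 : ∀ x, 0 ≤ h x) (hout : ∀ x ∉ I.ival, h x = 0) (hG : ∀ x ∈ I.ival, h x ≤ G x) {A : ℝ}
    (hGi : IntegrableOn (fun x => G x ^ 2) I.ival)
    (hA : ∫ x in I.ival, G x ^ 2 ≤ A * I.len ^ (1 - 2 / p)) : ∫ x, h x ^ p ≤ 1 + A := by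
  have hL := I.len_pos
  set t : ℝ := I.len ^ (-1 / p) with ht
  have htp : 0 < t := by positivity
  have e1 : t ^ p = I.len⁻¹ := by
    rw [ht, ← Real.rpow_mul hL.le, ← Real.rpow_neg_one]; congr 1; field_simp
  have e2 : t ^ (p - 2) * I.len ^ (1 - 2 / p) = 1 := by
    rw [ht, ← Real.rpow_mul hL.le, ← Real.rpow_add hL]
    have : -1 / p * (p - 2) + (1 - 2 / p) = 0 := by field_simp; ring
    rw [this, Real.rpow_zero]
  rw [← setIntegral_eq_integral_of_forall_compl_eq_zero (s := I.ival)
    (fun x hx => by rw [hout x hx, Real.zero_rpow hp0.ne'])]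
  have hi : IntegrableOn (fun x => t ^ p + t ^ (p - 2) * G x ^ 2) I.ival :=
    (integrableOn_const I.vol_ne_top).add (hGi.const_mul _)
  calc ∫ x in I.ival, h x ^ p ≤ ∫ x in I.ival, (t ^ p + t ^ (p - 2) * G x ^ 2) := by
        refine setIntegral_mono_on (hh.rpow hp0).integrable.integrableOn hi I.meas fun x hx => ?_
        refine le_trans (rpow_crude hp0 hp1 (h0 x) htp) ?_
        have := h0 x
        have := hG x hx
        gcongr
    _ = 1 + t ^ (p - 2) * ∫ x in I.ival, G x ^ 2 := by
        have hc : Integrable (fun _ : ℝ => t ^ p) (volume.restrict I.ival) :=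
          integrableOn_const I.vol_ne_top
        rw [integral_add hc (hGi.const_mul _), integral_const_mul,
          setIntegral_const, I.vol, e1, smul_eq_mul, mul_inv_cancel₀ hL.ne']
    _ ≤ 1 + t ^ (p - 2) * (A * I.len ^ (1 - 2 / p)) := by gcongr
    _ = 1 + A * (t ^ (p - 2) * I.len ^ (1 - 2 / p)) := by ring
    _ = 1 + A := by rw [e2, _root_.mul_one]

lemma squareFn_eq (f : ℝ → ℝ) (x : ℝ) : squareFn M f x =
    Real.sqrt (∑ P : Tile M, waveCoeff f P ^ 2 * P.ival.indicator 1 x / P.len) := by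
  rw [squareFn, finsum_eq_sum_of_fintype]

lemma sq_term_nonneg (f : ℝ → ℝ) (P : Tile M) (x : ℝ) :
    0 ≤ waveCoeff f P ^ 2 * P.ival.indicator 1 x / P.len := by
  have h := P.len_pos
  have : (0:ℝ) ≤ P.ival.indicator 1 x := Set.indicator_nonneg (by simp) _
  positivity

lemma squareFn_sq (f : ℝ → ℝ) (x : ℝ) : squareFn M f x ^ 2 =
    ∑ P : Tile M, waveCoeff f P ^ 2 * P.ival.indicator 1 x / P.len := by
  rw [squareFn_eq, Real.sq_sqrt (Finset.sum_nonneg fun P _ => sq_term_nonneg f P x)]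

lemma squareFn_nonneg (f : ℝ → ℝ) (x : ℝ) : 0 ≤ squareFn M f x := Real.sqrt_nonneg _

lemma not_mem_tile {x : ℝ} (hx : x ∉ Ico (0:ℝ) (2 ^ (M:ℤ))) (P : Tile M) : x ∉ P.ival := by
  intro h
  have := le_root P h
  rw [root_ival] at this
  exact hx this

lemma squareFn_test (f : ℝ → ℝ) : IsTestFun M (squareFn M f) := by
  constructor
  · intro x hx
    rw [squareFn_eq, Finset.sum_eq_zero, Real.sqrt_zero]
    intro P _
    simp [not_mem_tile hx P]
  · intro j x hx y hy
    rw [squareFn_eq, squareFn_eq]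
    congr 1
    refine Finset.sum_congr rfl fun P _ => ?_
    by_cases h : y ∈ P.ival
    · simp [h, (grid_mem hx hy P).2 h]
    · have : x ∉ P.ival := fun h' => h ((grid_mem hx hy P).1 h')
      simp [h, this]

lemma cancelMax_test (f : ℝ → ℝ) : IsTestFun M (cancelMax M f) := by
  constructor
  · intro x hx
    have : {r : ℝ | ∃ P : Tile M, x ∈ P.ival ∧ r = |tileAvg f P|} = ∅ := by
      ext r
      simp [not_mem_tile hx]
    rw [cancelMax, this, Real.sSup_empty]
  · intro j x hx y hy
    simp only [cancelMax, grid_mem hx hy]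

lemma cancelMax_nonneg (f : ℝ → ℝ) (x : ℝ) : 0 ≤ cancelMax M f x := by
  refine Real.sSup_nonneg ?_
  rintro r ⟨P, _, rfl⟩
  exact abs_nonneg _

lemma le_cancelMax (f : ℝ → ℝ) {x : ℝ} {P : Tile M} (hx : x ∈ P.ival) :
    |tileAvg f P| ≤ cancelMax M f x := by
  refine le_csSup ?_ ⟨P, hx, rfl⟩
  refine Set.Finite.bddAbove ((Set.finite_range (fun P : Tile M => |tileAvg f P|)).subset ?_)
  rintro r ⟨P, _, rfl⟩
  exact ⟨P, rfl⟩

lemma cancelMax_le {f : ℝ → ℝ} {x b : ℝ} (hb : 0 ≤ b)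
    (h : ∀ P : Tile M, x ∈ P.ival → |tileAvg f P| ≤ b) : cancelMax M f x ≤ b := by
  refine Real.sSup_le ?_ hb
  rintro r ⟨P, hP, rfl⟩
  exact h P hP

lemma atom_avg {p : ℝ} {I : Tile M} {a : ℝ → ℝ} (ha : IsHpAtom M p I a) {P : Tile M}
    (h : ¬ P.le I) : tileAvg a P = 0 := by
  rcases P.trichotomy I with h1 | h1 | h1
  · exact absurd h1 h
  · rw [tileAvg, setIntegral_eq_integral_of_forall_compl_eq_zero, ha.2.1, zero_div]
    intro x hx
    exact ha.2.2.1 x (fun hc => hx (h1 hc))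
  · rw [tileAvg, setInt_const P.meas (c := 0), mul_zero, zero_div]
    intro x hx
    exact ha.2.2.1 x (Set.disjoint_left.1 h1 hx)

lemma atom_wave {p : ℝ} {I : Tile M} {a : ℝ → ℝ} (ha : IsHpAtom M p I a) {P : Tile M}
    (h : ¬ P.le I) : waveCoeff a P = 0 := by
  rcases P.trichotomy I with h1 | h1 | h1
  · exact absurd h1 h
  · have hne : I ≠ P := by
      rintro rfl
      exact h (Tile.le_rfl' _)
    obtain ⟨c, hc⟩ := haar_const_on h1 hne
    have : ∀ x, a x * P.haar x = a x * c := by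
      intro x
      by_cases hx : x ∈ I.ival
      · rw [hc x hx]
      · rw [ha.2.2.1 x hx, zero_mul, zero_mul]
    unfold waveCoeff
    simp_rw [this]
    rw [integral_mul_const, ha.2.1, zero_mul]
  · have : ∀ x, a x * P.haar x = 0 := by
      intro x
      by_cases hx : x ∈ P.ival
      · rw [ha.2.2.1 x (Set.disjoint_left.1 h1 hx), zero_mul]
      · rw [haar_out hx, mul_zero]
    simp [waveCoeff, this]

lemma atom_S {p : ℝ} (hp0 : 0 < p) (hp1 : p ≤ 1) {I : Tile M} {a : ℝ → ℝ}
    (ha : IsHpAtom M p I a) : ∫ x, squareFn M a x ^ p ≤ 1 + 1 := by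
  have ht := (squareFn_test (M := M) a).comp (fun y => y ^ 2) (by simp)
  refine local_Lp hp0 hp1 I (G := squareFn M a) (squareFn_test a) (squareFn_nonneg a) ?_
    (fun x _ => le_rfl) ht.integrable.integrableOn ?_
  · intro x hx
    rw [squareFn_eq, Finset.sum_eq_zero, Real.sqrt_zero]
    intro P _
    by_cases h : P.le I
    · have : x ∉ P.ival := fun hc => hx (h hc)
      simp [this]
    · simp [atom_wave ha h]
  · rw [_root_.one_mul]
    refine le_trans ?_ ha.2.2.2
    calc ∫ x in I.ival, squareFn M a x ^ 2 ≤ ∫ x, squareFn M a x ^ 2 :=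
          setIntegral_le_integral ht.integrable (Filter.Eventually.of_forall fun x => sq_nonneg _)
      _ = ∑ P : Tile M, waveCoeff a P ^ 2 := by
          simp_rw [squareFn_sq]
          have e : ∀ (P : Tile M) (x : ℝ), waveCoeff a P ^ 2 * P.ival.indicator 1 x / P.len
              = (waveCoeff a P ^ 2 / P.len) * P.ival.indicator 1 x := fun P x => by ring
          simp_rw [e]
          rw [integral_finsetSum]
          · refine Finset.sum_congr rfl fun P _ => ?_
            rw [integral_const_mul, integral_indicator_one P.meas, P.vol]
            have := P.len_pos
            field_simp
          · intro P _
            refine Integrable.const_mul ?_ _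
            exact (integrable_indicator_iff P.meas).2 (integrableOn_const P.vol_ne_top)
      _ = ∫ x, a x ^ 2 := (parseval ha.1 ha.2.1).symm
      _ ≤ _ := le_rfl

lemma doob {a : ℝ → ℝ} (ha : IsTestFun M a) (Q : Tile M) : ∀ m : ℝ, |tileAvg a Q| ≤ m →
    ∃ G : ℝ → ℝ, IntegrableOn (fun x => G x ^ 2) Q.ival ∧
      (∀ P : Tile M, P.le Q → ∀ x ∈ P.ival, |tileAvg a P| ≤ G x) ∧ (∀ x ∈ Q.ival, m ≤ G x) ∧
      ∫ x in Q.ival, G x ^ 2 ≤ 4 * (∫ x in Q.ival, a x ^ 2)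
        - Q.len * (4 * m * |tileAvg a Q| - 2 * m ^ 2) := by
  have hai : Integrable (fun x => a x ^ 2) := (ha.comp (fun y => y ^ 2) (by simp)).integrable
  induction Q using Tile.ind with
  | leaf Q h =>
    intro m hm
    have hL := Q.len_pos
    refine ⟨fun _ => m, integrableOn_const Q.vol_ne_top, ?_, fun _ _ => le_rfl, ?_⟩
    · intro P hP x _
      rw [Tile.eq_of_le hP (by rw [h]; exact P.hk_lb)]
      exact hm
    · rw [setIntegral_const, Q.vol, smul_eq_mul,
        setInt_const Q.meas (c := |tileAvg a Q| ^ 2)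
          (fun x hx => by rw [avg_leaf ha Q h hx, sq_abs]), Q.vol]
      nlinarith [mul_nonneg hL.le (sq_nonneg (2 * |tileAvg a Q| - m))]
  | step Q h hl hr =>
    intro m hm
    classical
    have hL := Q.len_pos
    obtain ⟨Gl, il, bl, ml, el⟩ := hl (max m |tileAvg a (Q.lc h)|) (le_max_right _ _)
    obtain ⟨Gr, ir, br, mr, er⟩ := hr (max m |tileAvg a (Q.rc h)|) (le_max_right _ _)
    obtain ⟨G, vl, vr⟩ : ∃ G : ℝ → ℝ, (∀ x ∈ (Q.lc h).ival, G x = Gl x) ∧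
        (∀ x ∈ (Q.rc h).ival, G x = Gr x) := by
      refine ⟨fun x => if x ∈ Q.left then Gl x else Gr x, ?_, ?_⟩
      · intro x hx; rw [Tile.lc_ival] at hx; simp [hx]
      · intro x hx; rw [Tile.rc_ival] at hx; simp [Set.disjoint_right.1 Q.disj_lr hx]
    have hlow : ∀ x ∈ Q.ival, m ≤ G x := by
      intro x hx
      rw [← Q.union_lr, ← Q.lc_ival h, ← Q.rc_ival h] at hx
      rcases hx with hx | hx
      · rw [vl x hx]; exact (le_max_left _ _).trans (ml x hx)
      · rw [vr x hx]; exact (le_max_left _ _).trans (mr x hx)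
    have il' : IntegrableOn (fun x => G x ^ 2) (Q.lc h).ival :=
      il.congr_fun (fun x hx => by simp only [vl x hx]) (Q.lc h).meas
    have ir' : IntegrableOn (fun x => G x ^ 2) (Q.rc h).ival :=
      ir.congr_fun (fun x hx => by simp only [vr x hx]) (Q.rc h).meas
    have hint := integrableOn_split h il' ir'
    refine ⟨G, hint, ?_, hlow, ?_⟩
    · intro P hP x hx
      by_cases e : P = Q
      · subst e
        exact hm.trans (hlow x hx)
      · rcases Tile.le_child h hP e with h1 | h1
        · have := bl P h1 x hx
          rwa [← vl x (h1 hx)] at this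
        · have := br P h1 x hx
          rwa [← vr x (h1 hx)] at this
    · rw [setInt_split hint, setInt_split hai.integrableOn, ← Q.lc_ival h, ← Q.rc_ival h,
        setIntegral_congr_fun (Q.lc h).meas (g := fun x => Gl x ^ 2)
          (fun x hx => by simp only [vl x hx]),
        setIntegral_congr_fun (Q.rc h).meas (g := fun x => Gr x ^ 2)
          (fun x hx => by simp only [vr x hx])]
      rw [Q.lc_len] at el
      rw [Q.rc_len] at er
      have hmid := tileAvg_mid ha.integrable Q h
      have hm0 : 0 ≤ m := (abs_nonneg _).trans hm
      have hA : |tileAvg a Q| ≤ (|tileAvg a (Q.lc h)| + |tileAvg a (Q.rc h)|) / 2 := by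
        rw [hmid, abs_div, abs_two]
        have := abs_add_le (tileAvg a (Q.lc h)) (tileAvg a (Q.rc h))
        linarith
      have key : ∀ y : ℝ, 4 * m * y - 2 * m ^ 2 ≤ 4 * (max m y) * y - 2 * (max m y) ^ 2 := by
        intro y
        rcases le_total m y with h | h
        · rw [max_eq_right h]; nlinarith [sq_nonneg (y - m)]
        · rw [max_eq_left h]
      have k1 := mul_le_mul_of_nonneg_left (key |tileAvg a (Q.lc h)|) (half_pos hL).le
      have k2 := mul_le_mul_of_nonneg_left (key |tileAvg a (Q.rc h)|) (half_pos hL).le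
      have k3 := mul_le_mul_of_nonneg_left hA (mul_nonneg hL.le hm0)
      nlinarith

lemma atom_M {p : ℝ} (hp0 : 0 < p) (hp1 : p ≤ 1) {I : Tile M} {a : ℝ → ℝ}
    (ha : IsHpAtom M p I a) : ∫ x, cancelMax M a x ^ p ≤ 1 + 4 := by
  obtain ⟨G, hGi, hG, hm, hb⟩ := doob ha.1 I _ le_rfl
  have h0 : ∀ x ∈ I.ival, 0 ≤ G x := fun x hx => (abs_nonneg _).trans (hm x hx)
  have hai : Integrable (fun x => a x ^ 2) := (ha.1.comp (fun y => y ^ 2) (by simp)).integrable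
  refine local_Lp hp0 hp1 I (G := G) (cancelMax_test a) (cancelMax_nonneg a) ?_ ?_ hGi ?_
  · intro x hx
    refine le_antisymm (cancelMax_le le_rfl fun P hP => ?_) (cancelMax_nonneg a x)
    rw [atom_avg ha (fun h => hx (h hP)), abs_zero]
  · intro x hx
    refine cancelMax_le (h0 x hx) fun P hP => ?_
    by_cases h : P.le I
    · exact hG P h x hP
    · rw [atom_avg ha h, abs_zero]; exact h0 x hx
  · have h1 : ∫ x in I.ival, a x ^ 2 ≤ ∫ x, a x ^ 2 :=
      setIntegral_le_integral hai (Filter.Eventually.of_forall fun x => sq_nonneg _)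
    have h2 := ha.2.2.2
    have h3 : 0 ≤ I.len * |tileAvg a I| ^ 2 := mul_nonneg I.len_pos.le (sq_nonneg _)
    nlinarith

lemma rpow_sum_le' {ι : Type*} (s : Finset ι) (g : ι → ℝ) {p : ℝ} (hp0 : 0 < p) (hp1 : p ≤ 1)
    (hg : ∀ i ∈ s, 0 ≤ g i) : (∑ i ∈ s, g i) ^ p ≤ ∑ i ∈ s, g i ^ p := by
  classical
  induction s using Finset.induction_on with
  | empty => simp [Real.zero_rpow hp0.ne']
  | insert i s hi ih =>
    rw [Finset.sum_insert hi, Finset.sum_insert hi]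
    have h1 := ih fun j hj => hg j (Finset.mem_insert_of_mem hj)
    have h2 := Real.rpow_add_le_add_rpow (hg i (Finset.mem_insert_self _ _))
      (Finset.sum_nonneg fun j hj => hg j (Finset.mem_insert_of_mem hj)) hp0.le hp1
    linarith

lemma sum_bound {p : ℝ} (hp0 : 0 < p) (hp1 : p ≤ 1) (II : Finset (Tile M)) (c : Tile M → ℝ)
    (hc : ∀ I ∈ II, 0 ≤ c I) (h : ℝ → ℝ) (H : Tile M → ℝ → ℝ) (hh : IsTestFun M h)
    (hH : ∀ I, IsTestFun M (H I)) (h0 : ∀ x, 0 ≤ h x) (H0 : ∀ I x, 0 ≤ H I x)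
    (hle : ∀ x, h x ≤ ∑ I ∈ II, c I * H I x) {K : ℝ} (hK : ∀ I ∈ II, ∫ x, H I x ^ p ≤ K) :
    ∫ x, h x ^ p ≤ K * ∑ I ∈ II, c I ^ p := by
  calc ∫ x, h x ^ p ≤ ∫ x, ∑ I ∈ II, c I ^ p * H I x ^ p := by
        refine integral_mono (hh.rpow hp0).integrable
          (integrable_finsetSum _ fun I _ => ((hH I).rpow hp0).integrable.const_mul _) fun x => ?_
        refine (Real.rpow_le_rpow (h0 x) (hle x) hp0.le).trans ?_
        refine (rpow_sum_le' II _ hp0 hp1 fun I hI => mul_nonneg (hc I hI) (H0 I x)).trans ?_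
        exact Finset.sum_le_sum fun I hI => (Real.mul_rpow (hc I hI) (H0 I x)).le
    _ = ∑ I ∈ II, c I ^ p * ∫ x, H I x ^ p := by
        rw [integral_finsetSum _ fun I _ => ((hH I).rpow hp0).integrable.const_mul _]
        simp_rw [integral_const_mul]
    _ ≤ ∑ I ∈ II, c I ^ p * K := Finset.sum_le_sum fun I hI =>
        mul_le_mul_of_nonneg_left (hK I hI) (Real.rpow_nonneg (hc I hI) _)
    _ = _ := by rw [← Finset.sum_mul, _root_.mul_comm]

lemma atoms_M {p : ℝ} (hp0 : 0 < p) (hp1 : p ≤ 1) {f : ℝ → ℝ} {B : ℝ}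
    (h : HasAtomicDecomp M p f B) : ∫ x, cancelMax M f x ^ p ≤ 5 * B ^ p := by
  obtain ⟨II, c, g, h1, h2, h3⟩ := h
  have hb := sum_bound hp0 hp1 II c (fun I hI => (h1 I hI).1) (cancelMax M f)
    (fun I => cancelMax M (g I)) (cancelMax_test f) (fun I => cancelMax_test _)
    (cancelMax_nonneg f) (fun I => cancelMax_nonneg _) ?_ (K := 5)
    (fun I hI => (atom_M hp0 hp1 (h1 I hI).2).trans (by norm_num))
  · refine hb.trans ?_
    gcongr
  · intro x
    refine cancelMax_le (Finset.sum_nonneg fun I hI =>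
      mul_nonneg (h1 I hI).1 (cancelMax_nonneg _ _)) fun P hP => ?_
    have e : tileAvg f P = ∑ I ∈ II, c I * tileAvg (g I) P := by
      unfold tileAvg
      simp_rw [h2]
      rw [integral_finsetSum _ fun I hI =>
        ((h1 I hI).2.1.integrable.integrableOn (s := P.ival)).const_mul _]
      simp_rw [integral_const_mul]
      rw [Finset.sum_div]
      exact Finset.sum_congr rfl fun I _ => by ring
    rw [e]
    refine (Finset.abs_sum_le_sum_abs _ _).trans (Finset.sum_le_sum fun I hI => ?_)
    rw [abs_mul, abs_of_nonneg (h1 I hI).1]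
    exact mul_le_mul_of_nonneg_left (le_cancelMax _ hP) (h1 I hI).1

/-- vector whose Euclidean norm is the square function -/
def sqVec (f : ℝ → ℝ) (x : ℝ) : EuclideanSpace ℝ (Tile M) :=
  WithLp.toLp 2 fun P => waveCoeff f P * (Real.sqrt (P.ival.indicator 1 x / P.len))

lemma sqVec_norm (f : ℝ → ℝ) (x : ℝ) : ‖(sqVec f x : EuclideanSpace ℝ (Tile M))‖ = squareFn M f x := by
  rw [EuclideanSpace.norm_eq, squareFn_eq]
  congr 1
  refine Finset.sum_congr rfl fun P _ => ?_
  have h := P.len_pos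
  have : (0:ℝ) ≤ P.ival.indicator 1 x := Set.indicator_nonneg (by simp) _
  rw [sqVec, Real.norm_eq_abs, sq_abs, mul_pow, Real.sq_sqrt (by positivity)]
  ring

lemma atoms_S {p : ℝ} (hp0 : 0 < p) (hp1 : p ≤ 1) {f : ℝ → ℝ} {B : ℝ}
    (h : HasAtomicDecomp M p f B) : ∫ x, squareFn M f x ^ p ≤ 5 * B ^ p := by
  obtain ⟨II, c, g, h1, h2, h3⟩ := h
  have hb := sum_bound hp0 hp1 II c (fun I hI => (h1 I hI).1) (squareFn M f)
    (fun I => squareFn M (g I)) (squareFn_test f) (fun I => squareFn_test _)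
    (squareFn_nonneg f) (fun I => squareFn_nonneg _) ?_ (K := 5)
    (fun I hI => (atom_S hp0 hp1 (h1 I hI).2).trans (by norm_num))
  · refine hb.trans ?_
    gcongr
  · intro x
    have e : (sqVec f x : EuclideanSpace ℝ (Tile M)) = ∑ I ∈ II, c I • sqVec (g I) x := by
      ext P
      have e : waveCoeff f P = ∑ I ∈ II, c I * waveCoeff (g I) P := by
        unfold waveCoeff
        simp_rw [h2, Finset.sum_mul, _root_.mul_assoc]
        rw [integral_finsetSum _ fun I hI =>
          (haar_mul_integrable P (h1 I hI).2.1.integrable).const_mul _]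
        simp_rw [integral_const_mul]
      simp [sqVec, e, Finset.sum_mul, _root_.mul_assoc]
    rw [← sqVec_norm, e]
    refine (norm_sum_le _ _).trans (Finset.sum_le_sum fun I hI => ?_)
    rw [norm_smul, Real.norm_of_nonneg (h1 I hI).1, sqVec_norm]



lemma geom_sum {q : ℝ} (hq : 1 < q) (N : Finset ℤ) :
    ∀ m : ℤ, (∀ n ∈ N, n ≤ m) → ∑ n ∈ N, q ^ n ≤ q / (q - 1) * q ^ m := by
  have hq1 : 0 < q - 1 := by linarith
  induction N using Finset.induction_on_max with
  | empty => intro m _; rw [Finset.sum_empty]; positivity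
  | insert a s hs ih =>
    intro m hm
    rw [Finset.sum_insert (fun h => lt_irrefl _ (hs a h))]
    have h1 := ih (a - 1) (fun n hn => by have := hs n hn; omega)
    have h2 : q ^ a ≤ q ^ m := zpow_le_zpow_right₀ hq.le (hm a (Finset.mem_insert_self _ _))
    calc _ ≤ q ^ a + q / (q - 1) * q ^ (a - 1) := by linarith
      _ = q / (q - 1) * q ^ a := by
        rw [zpow_sub_one₀ (by linarith)]; field_simp; ring
      _ ≤ _ := by gcongr

/-- abstract atomic decomposition -/
theorem decomp {p : ℝ} (hp0 : 0 < p) {f : ℝ → ℝ} (hf : IsTestFun M f) (hf0 : ∫ x, f x = 0)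
    (s : Tile M → ℝ) (hmono : ∀ P Q : Tile M, P.le Q → s Q ≤ s P)
    (hs0 : ∀ P : Tile M, waveCoeff f P ≠ 0 → 0 < s P)
    (hE : ∀ (Q : Tile M) (L : ℝ), 0 < L → s Q ≤ L → ∀ F : Finset (Tile M),
      (∀ P ∈ F, P.le Q ∧ s P ≤ L) → ∑ P ∈ F, waveCoeff f P ^ 2 ≤ L ^ 2 * Q.len)
    (F : ℝ → ℝ) (hF : IsTestFun M F) (hF0 : ∀ x, 0 ≤ F x)
    (hH : ∀ Q : Tile M, -(M:ℤ) < Q.k → ∀ l : ℝ, 0 < l → l < s Q →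
      (∀ R : Tile M, Q.le R → Q ≠ R → s R ≤ l) →
      ∃ H : Set ℝ, MeasurableSet H ∧ H ⊆ Q.ival ∧ Q.len ≤ 2 * volume.real H ∧ ∀ x ∈ H, l < F x)
    {B : ℝ} (hB : 2 * 2 ^ p * ((2:ℝ) ^ p / (2 ^ p - 1)) * (∫ x, F x ^ p) ≤ B ^ p) :
    HasAtomicDecomp M p f B := by
  classical
  have hlev : ∀ P : Tile M, ∃ n : ℤ, 0 < s P → s P ∈ Ioc ((2:ℝ) ^ n) (2 ^ (n + 1)) := by
    intro P
    by_cases h : 0 < s P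
    · obtain ⟨n, hn⟩ := exists_mem_Ioc_zpow h (by norm_num : (1:ℝ) < 2)
      exact ⟨n, fun _ => hn⟩
    · exact ⟨0, fun h' => absurd h' h⟩
  choose lev hlev using hlev
  have huniq : ∀ {y : ℝ} {m n : ℤ}, (2:ℝ) ^ m < y → y ≤ 2 ^ (n + 1) → m ≤ n := by
    intro y m n h1 h2
    have := (zpow_lt_zpow_iff_right₀ (by norm_num : (1:ℝ) < 2)).1 (h1.trans_le h2)
    omega
  -- active tiles and tops
  set A : Finset (Tile M) := Finset.univ.filter (fun P => -(M:ℤ) < P.k ∧ 0 < s P) with hA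
  set T : Finset (Tile M) := A.filter
    (fun Q => ∀ R : Tile M, Q.le R → Q ≠ R → s R ≤ (2:ℝ) ^ lev Q) with hT
  have htop : ∀ P : Tile M, ∃ Q : Tile M, P ∈ A → Q ∈ T ∧ P.le Q ∧ lev P = lev Q := by
    intro P
    by_cases hP : P ∈ A
    · have hP' := hP
      rw [hA, Finset.mem_filter] at hP'
      have hl := hlev P hP'.2.2
      have hne : (Finset.univ.filter (fun R : Tile M => P.le R ∧ (2:ℝ) ^ lev P < s R)).Nonempty :=
        ⟨P, by simp [Tile.le_rfl', hl.1]⟩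
      obtain ⟨Q, hQ, hmax⟩ := Finset.exists_max_image _ (fun R : Tile M => R.k) hne
      simp only [Finset.mem_filter, Finset.mem_univ, true_and] at hQ hmax
      have hsQ : 0 < s Q := (two_zpow_pos _).trans hQ.2
      have hlQ := hlev Q hsQ
      have e : lev P = lev Q := by
        refine le_antisymm (huniq hQ.2 hlQ.2) (huniq hlQ.1 ((hmono P Q hQ.1).trans hl.2))
      refine ⟨Q, fun _ => ⟨?_, hQ.1, e⟩⟩
      simp only [hT, hA, Finset.mem_filter, Finset.mem_univ, true_and]
      refine ⟨⟨lt_of_lt_of_le hP'.2.1 (Tile.k_le hQ.1), hsQ⟩, fun R hR hne => ?_⟩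
      by_contra hc
      push Not at hc
      have := hmax R ⟨Tile.le_trans' hQ.1 hR, by rw [e]; exact hc⟩
      have := Tile.k_lt hR hne
      omega
    · exact ⟨P, fun h => absurd h hP⟩
  choose τ hτ using htop
  have hTpos : ∀ Q ∈ T, -(M:ℤ) < Q.k ∧ 0 < s Q ∧
      ∀ R : Tile M, Q.le R → Q ≠ R → s R ≤ (2:ℝ) ^ lev Q := by
    intro Q hQ
    simp only [hT, hA, Finset.mem_filter, Finset.mem_univ, true_and] at hQ
    exact ⟨hQ.1.1, hQ.1.2, hQ.2⟩
  set c : Tile M → ℝ := fun Q => (2:ℝ) ^ (lev Q + 1) * Q.len ^ (1 / p) with hc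
  have hcpos : ∀ Q, 0 < c Q := fun Q =>
    mul_pos (two_zpow_pos _) (Real.rpow_pos_of_pos Q.len_pos _)
  refine ⟨T, c, fun Q x => (c Q)⁻¹ * ∑ P ∈ A with τ P = Q, waveCoeff f P * P.haar x, ?_, ?_, ?_⟩
  · intro Q hQ
    refine ⟨(hcpos Q).le, ?_, ?_, ?_, ?_⟩
    · refine IsTestFun.comp (f := fun x => ∑ P ∈ A with τ P = Q, waveCoeff f P * P.haar x)
        ?_ (fun y => (c Q)⁻¹ * y) (mul_zero _)
      refine IsTestFun.sum _ _ fun P hP => ?_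
      simp only [hA, Finset.mem_filter] at hP
      exact (haar_test hP.1.2.1).comp (fun y => waveCoeff f P * y) (mul_zero _)
    · rw [integral_const_mul, integral_finsetSum _ fun P _ => (haar_integrable P).const_mul _]
      simp [integral_const_mul, haar_int]
    · intro x hx
      beta_reduce
      rw [Finset.sum_eq_zero, mul_zero]
      intro P hP
      rw [Finset.mem_filter] at hP
      have := (hτ P hP.1).2.1
      rw [hP.2] at this
      rw [haar_out (fun h => hx (this h)), mul_zero]
    · simp_rw [mul_pow]
      rw [integral_const_mul, haar_norm]
      have hl := hlev Q (hTpos Q hQ).2.1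
      have hb := hE Q ((2:ℝ) ^ (lev Q + 1)) (two_zpow_pos _) hl.2
        (Finset.filter (fun P => τ P = Q) A) (by
          intro P hP
          rw [Finset.mem_filter] at hP
          obtain ⟨h1, h2, h3⟩ := hτ P hP.1
          rw [hP.2] at h2 h3
          refine ⟨h2, ?_⟩
          rw [← h3]
          have := hP.1
          simp only [hA, Finset.mem_filter] at this
          exact (hlev P this.2.2).2)
      have hL := Q.len_pos
      have hz := two_zpow_pos (lev Q + 1)
      calc _ ≤ (c Q)⁻¹ ^ 2 * (((2:ℝ) ^ (lev Q + 1)) ^ 2 * Q.len) := by gcongr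
        _ = Q.len * ((Q.len ^ (1 / p)) ^ 2)⁻¹ := by
          simp only [hc]
          have : Q.len ^ (1 / p) ≠ 0 := (Real.rpow_pos_of_pos hL _).ne'
          field_simp
        _ = Q.len ^ (1 - 2 / p) := by
          rw [Real.rpow_sub hL, Real.rpow_one, div_eq_mul_inv]
          congr 2
          rw [← Real.rpow_natCast, ← Real.rpow_mul hL.le]
          congr 1; push_cast; ring
        _ ≤ _ := le_rfl
  · intro x
    have e : ∀ Q ∈ T, c Q * ((c Q)⁻¹ * ∑ P ∈ A with τ P = Q, waveCoeff f P * P.haar x)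
        = ∑ P ∈ A with τ P = Q, waveCoeff f P * P.haar x := by
      intro Q _
      rw [← _root_.mul_assoc, mul_inv_cancel₀ (hcpos Q).ne', _root_.one_mul]
    rw [Finset.sum_congr rfl e, Finset.sum_fiberwise_of_maps_to (fun P hP => (hτ P hP).1),
      haar_full hf hf0 x]
    symm
    refine Finset.sum_subset (Finset.subset_univ _) fun P _ hP => ?_
    have : waveCoeff f P = 0 := by
      by_contra hne
      refine hP ?_
      simp only [hA, Finset.mem_filter, Finset.mem_univ, true_and]
      refine ⟨lt_of_le_of_ne P.hk_lb fun h => hne (wave_leaf hf P h.symm), hs0 P hne⟩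
    rw [this, zero_mul]
  · refine le_trans ?_ hB
    set q : ℝ := (2:ℝ) ^ p with hq
    have hq1 : 1 < q := Real.one_lt_rpow (by norm_num) hp0
    have hpow : ∀ n : ℤ, ((2:ℝ) ^ n) ^ p = q ^ n := by
      intro n
      rw [hq, ← Real.rpow_intCast, ← Real.rpow_intCast, ← Real.rpow_mul (by norm_num),
        ← Real.rpow_mul (by norm_num), _root_.mul_comm]
    have hex : ∀ Q : Tile M, ∃ H : Set ℝ, Q ∈ T → (MeasurableSet H ∧ H ⊆ Q.ival ∧
        Q.len ≤ 2 * volume.real H ∧ ∀ x ∈ H, (2:ℝ) ^ lev Q < F x) := by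
      intro Q
      by_cases hQ : Q ∈ T
      · obtain ⟨h1, h2, h3⟩ := hTpos Q hQ
        obtain ⟨H, hH'⟩ := hH Q h1 _ (two_zpow_pos (lev Q)) (hlev Q h2).1 h3
        exact ⟨H, fun _ => hH'⟩
      · exact ⟨∅, fun h => absurd h hQ⟩
    choose H hHp using hex
    have hint : ∀ Q ∈ T, Integrable (fun x => q ^ lev Q * (H Q).indicator 1 x) := by
      intro Q hQ
      obtain ⟨h1, h2, _⟩ := hHp Q hQ
      refine Integrable.const_mul ?_ _
      exact (integrable_indicator_iff h1).2
        (integrableOn_const (ne_top_of_le_ne_top Q.vol_ne_top (measure_mono h2)))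
    have hpt : ∀ x, ∑ Q ∈ T, q ^ lev Q * (H Q).indicator 1 x ≤ q / (q - 1) * F x ^ p := by
      intro x
      have e : ∑ Q ∈ T, q ^ lev Q * (H Q).indicator 1 x
          = ∑ Q ∈ T with x ∈ H Q, q ^ lev Q := by
        rw [Finset.sum_filter (s := T) (p := fun Q => x ∈ H Q)]
        refine Finset.sum_congr rfl fun Q _ => ?_
        by_cases h : x ∈ H Q <;> simp [h]
      have hinj : Set.InjOn lev (T.filter (fun Q => x ∈ H Q) : Finset (Tile M)) := by
        have key : ∀ Q ∈ T, ∀ R ∈ T, Q.le R → lev Q = lev R → Q = R := by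
          intro Q hQ R hR hle he
          by_contra hne
          have h1 := (hTpos Q hQ).2.2 R hle hne
          have h2 := (hlev R (hTpos R hR).2.1).1
          rw [he] at h1
          linarith
        intro Q hQ R hR he
        rw [Finset.mem_coe, Finset.mem_filter] at hQ hR
        have hxQ := (hHp Q hQ.1).2.1 hQ.2
        have hxR := (hHp R hR.1).2.1 hR.2
        rcases le_total Q.k R.k with hk | hk
        · exact key Q hQ.1 R hR.1 (Tile.le_of_mem hk hxQ hxR) he
        · exact (key R hR.1 Q hQ.1 (Tile.le_of_mem hk hxR hxQ) he.symm).symm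
      rw [e, ← Finset.sum_image (f := fun n => q ^ n) hinj]
      rcases (Finset.image lev (T.filter (fun Q => x ∈ H Q))).eq_empty_or_nonempty with h | h
      · rw [h, Finset.sum_empty]
        have := hF0 x
        have : 0 < q - 1 := by linarith
        positivity
      · refine (geom_sum hq1 _ ((Finset.image lev (T.filter (fun Q => x ∈ H Q))).max' h) (fun n hn => Finset.le_max' _ n hn)).trans ?_
        have hm := Finset.max'_mem _ h
        obtain ⟨Q, hQ, hQe⟩ := Finset.mem_image.1 hm
        rw [← hQe, ← hpow]
        rw [Finset.mem_filter] at hQ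
        have h4 := (hHp Q hQ.1).2.2.2 x hQ.2
        have : 0 < q - 1 := by linarith
        have := two_zpow_pos (lev Q)
        gcongr
    have hq0 : 0 < q := by linarith
    calc ∑ Q ∈ T, c Q ^ p = ∑ Q ∈ T, q * (q ^ lev Q * Q.len) := by
          refine Finset.sum_congr rfl fun Q _ => ?_
          have hL := Q.len_pos
          simp only [hc]
          rw [Real.mul_rpow (two_zpow_pos _).le (Real.rpow_nonneg hL.le _), hpow,
            ← Real.rpow_mul hL.le, one_div, inv_mul_cancel₀ hp0.ne', Real.rpow_one,
            zpow_add_one₀ hq0.ne']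
          ring
      _ ≤ ∑ Q ∈ T, q * (q ^ lev Q * (2 * volume.real (H Q))) := by
          refine Finset.sum_le_sum fun Q hQ => ?_
          have := (hHp Q hQ).2.2.1
          have := zpow_pos hq0 (lev Q)
          gcongr
      _ = 2 * q * ∑ Q ∈ T, q ^ lev Q * volume.real (H Q) := by
          rw [Finset.mul_sum]
          exact Finset.sum_congr rfl fun Q _ => by ring
      _ = 2 * q * ∫ x, ∑ Q ∈ T, q ^ lev Q * (H Q).indicator 1 x := by
          rw [integral_finsetSum _ hint]
          congr 1
          refine Finset.sum_congr rfl fun Q hQ => ?_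
          rw [integral_const_mul, integral_indicator_one (hHp Q hQ).1]
      _ ≤ 2 * q * ∫ x, q / (q - 1) * F x ^ p := by
          refine mul_le_mul_of_nonneg_left ?_ (by positivity)
          exact integral_mono (integrable_finsetSum _ hint)
            ((hF.rpow hp0).integrable.const_mul _) hpt
      _ = 2 * q * (q / (q - 1)) * ∫ x, F x ^ p := by rw [integral_const_mul]; ring



/-- ancestors -/
def Tile.anc (P : Tile M) : Finset (Tile M) := by
  classical exact Finset.univ.filter (fun R => P.le R)

@[simp] lemma Tile.mem_anc {P R : Tile M} : R ∈ P.anc ↔ P.le R := by simp [Tile.anc]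

lemma Tile.self_anc (P : Tile M) : P ∈ P.anc := by simp [Tile.le_rfl']

lemma Tile.anc_mono {P Q : Tile M} (h : P.le Q) : Q.anc ⊆ P.anc := by
  intro R hR
  rw [Tile.mem_anc] at *
  exact Tile.le_trans' h hR

/-- truncated square function at a tile -/
def sS (f : ℝ → ℝ) (P : Tile M) : ℝ := Real.sqrt (∑ R ∈ P.anc, waveCoeff f R ^ 2 / R.len)

lemma sS_term (f : ℝ → ℝ) (R : Tile M) : 0 ≤ waveCoeff f R ^ 2 / R.len :=
  div_nonneg (sq_nonneg _) R.len_pos.le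

lemma sS_le_squareFn (f : ℝ → ℝ) {P : Tile M} {x : ℝ} (hx : x ∈ P.ival) :
    sS f P ≤ squareFn M f x := by
  rw [sS, squareFn_eq]
  refine Real.sqrt_le_sqrt ?_
  refine le_trans (Finset.sum_le_sum fun R hR => ?_)
    (Finset.sum_le_sum_of_subset_of_nonneg (Finset.subset_univ P.anc)
      fun R _ _ => sq_term_nonneg f R x)
  rw [Tile.mem_anc] at hR
  simp [hR hx]

theorem decomp_S {p : ℝ} (hp0 : 0 < p) {f : ℝ → ℝ} (hf : IsTestFun M f) (hf0 : ∫ x, f x = 0)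
    {B : ℝ} (hB : 2 * 2 ^ p * ((2:ℝ) ^ p / (2 ^ p - 1)) * (∫ x, squareFn M f x ^ p) ≤ B ^ p) :
    HasAtomicDecomp M p f B := by
  refine decomp hp0 hf hf0 (sS f) ?_ ?_ ?_ (squareFn M f) (squareFn_test f) (squareFn_nonneg f)
    ?_ hB
  · intro P Q h
    exact Real.sqrt_le_sqrt (Finset.sum_le_sum_of_subset_of_nonneg (Tile.anc_mono h)
      fun R _ _ => sS_term f R)
  · intro P hP
    refine Real.sqrt_pos.2 (Finset.sum_pos' (fun R _ => sS_term f R) ⟨P, P.self_anc, ?_⟩)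
    have := P.len_pos
    positivity
  · intro Q L hL hQ F hF
    have hpt : ∀ x ∈ Q.ival, ∑ P ∈ F, waveCoeff f P ^ 2 / P.len * P.ival.indicator 1 x ≤ L ^ 2 := by
      classical
      intro x hx
      have e : ∑ P ∈ F, waveCoeff f P ^ 2 / P.len * P.ival.indicator 1 x
          = ∑ P ∈ F with x ∈ P.ival, waveCoeff f P ^ 2 / P.len := by
        rw [Finset.sum_filter]
        refine Finset.sum_congr rfl fun P _ => ?_
        by_cases h : x ∈ P.ival <;> simp [h]
      rw [e]
      rcases (F.filter (fun P => x ∈ P.ival)).eq_empty_or_nonempty with h | h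
      · rw [h, Finset.sum_empty]; positivity
      · obtain ⟨P, hP, hmin⟩ := Finset.exists_min_image _ (fun R : Tile M => R.k) h
        rw [Finset.mem_filter] at hP
        refine le_trans (Finset.sum_le_sum_of_subset_of_nonneg (t := P.anc) ?_
          fun R _ _ => sS_term f R) ?_
        · intro R hR
          have hk := hmin R hR
          rw [Finset.mem_filter] at hR
          rw [Tile.mem_anc]
          exact Tile.le_of_mem hk hP.2 hR.2
        · have := (hF P hP.1).2
          exact (Real.sqrt_le_left hL.le).1 this
    have hi : ∀ P ∈ F, IntegrableOn
        (fun x => waveCoeff f P ^ 2 / P.len * P.ival.indicator (1 : ℝ → ℝ) x) Q.ival := by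
      intro P _
      refine Integrable.integrableOn (Integrable.const_mul ?_ _)
      exact (integrable_indicator_iff P.meas).2 (integrableOn_const P.vol_ne_top)
    calc ∑ P ∈ F, waveCoeff f P ^ 2
        = ∑ P ∈ F, ∫ x in Q.ival, waveCoeff f P ^ 2 / P.len * P.ival.indicator 1 x := by
          refine Finset.sum_congr rfl fun P hP => ?_
          rw [integral_const_mul, setIntegral_eq_integral_of_forall_compl_eq_zero,
            integral_indicator_one P.meas, P.vol]
          · have := P.len_pos
            field_simp
          · intro x hx
            have : x ∉ P.ival := fun h => hx ((hF P hP).1 h)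
            simp [this]
      _ = ∫ x in Q.ival, ∑ P ∈ F, waveCoeff f P ^ 2 / P.len * P.ival.indicator 1 x :=
          (integral_finsetSum _ hi).symm
      _ ≤ ∫ x in Q.ival, L ^ 2 := setIntegral_mono_on (integrable_finsetSum _ hi)
          (integrableOn_const Q.vol_ne_top) Q.meas hpt
      _ = L ^ 2 * Q.len := by
          rw [setIntegral_const, Q.vol, smul_eq_mul, _root_.mul_comm]
  · intro Q _ l _ hl _
    refine ⟨Q.ival, Q.meas, Subset.rfl, ?_, fun x hx => hl.trans_le (sS_le_squareFn f hx)⟩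
    rw [Q.vol]
    linarith [Q.len_pos]

/-- larger of the averages over the two halves -/
def vM (f : ℝ → ℝ) (P : Tile M) : ℝ :=
  max |2 * (∫ x in P.left, f x) / P.len| |2 * (∫ x in P.right, f x) / P.len|

/-- predictable maximal function at a tile -/
def sM (f : ℝ → ℝ) (P : Tile M) : ℝ := P.anc.sup' ⟨P, P.self_anc⟩ (vM f)

lemma vM_le_sM (f : ℝ → ℝ) (P : Tile M) : vM f P ≤ sM f P := Finset.le_sup' _ P.self_anc

lemma vM_lc (f : ℝ → ℝ) (P : Tile M) (h : -(M:ℤ) < P.k) : |tileAvg f (P.lc h)| ≤ vM f P := by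
  rw [tileAvg_lc]; exact le_max_left _ _

lemma vM_rc (f : ℝ → ℝ) (P : Tile M) (h : -(M:ℤ) < P.k) : |tileAvg f (P.rc h)| ≤ vM f P := by
  rw [tileAvg_rc]; exact le_max_right _ _

lemma vM_avg {f : ℝ → ℝ} (hf : Integrable f) (P : Tile M) : |tileAvg f P| ≤ vM f P := by
  have h1 : |2 * (∫ x in P.left, f x) / P.len| ≤ vM f P := le_max_left _ _
  have h2 : |2 * (∫ x in P.right, f x) / P.len| ≤ vM f P := le_max_right _ _
  have e : tileAvg f P = (2 * (∫ x in P.left, f x) / P.len + 2 * (∫ x in P.right, f x) / P.len) / 2 := by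
    rw [tileAvg, setInt_split hf.integrableOn]; ring
  rw [e, abs_div, abs_two]
  have := abs_add_le (2 * (∫ x in P.left, f x) / P.len) (2 * (∫ x in P.right, f x) / P.len)
  linarith

lemma sM_mono (f : ℝ → ℝ) {P Q : Tile M} (h : P.le Q) : sM f Q ≤ sM f P :=
  Finset.sup'_mono _ (Tile.anc_mono h) _

lemma energy_M {f : ℝ → ℝ} (hf : IsTestFun M f) {L : ℝ} (hL : 0 < L) (Q : Tile M) :
    |tileAvg f Q| ≤ L → ∑ P ∈ Q.sub, (if sM f P ≤ L then waveCoeff f P ^ 2 else 0)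
      ≤ Q.len * (L ^ 2 - tileAvg f Q ^ 2) := by
  induction Q using Tile.ind with
  | leaf Q h =>
    intro hQ
    have := sq_le_sq' (abs_le.1 hQ).1 (abs_le.1 hQ).2
    rw [Q.sum_sub_leaf h, wave_leaf hf Q h]
    have h0 := Q.len_pos
    have : 0 ≤ Q.len * (L ^ 2 - tileAvg f Q ^ 2) := mul_nonneg h0.le (by linarith)
    simpa using this
  | step Q h hl hr =>
    intro hQ
    by_cases hs : sM f Q ≤ L
    · have hv := (vM_le_sM f Q).trans hs
      have h1 := hl ((vM_lc f Q h).trans hv)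
      have h2 := hr ((vM_rc f Q h).trans hv)
      rw [Q.lc_len] at h1
      rw [Q.rc_len] at h2
      rw [Q.sum_sub_step h, if_pos hs]
      have := wave_sq hf.integrable Q h
      nlinarith
    · have := sq_le_sq' (abs_le.1 hQ).1 (abs_le.1 hQ).2
      rw [Finset.sum_eq_zero]
      · exact mul_nonneg Q.len_pos.le (by linarith)
      · intro P hP
        rw [Tile.mem_sub] at hP
        rw [if_neg]
        intro hc
        exact hs ((sM_mono f hP).trans hc)

theorem decomp_M {p : ℝ} (hp0 : 0 < p) {f : ℝ → ℝ} (hf : IsTestFun M f) (hf0 : ∫ x, f x = 0)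
    {B : ℝ} (hB : 2 * 2 ^ p * ((2:ℝ) ^ p / (2 ^ p - 1)) * (∫ x, cancelMax M f x ^ p) ≤ B ^ p) :
    HasAtomicDecomp M p f B := by
  refine decomp hp0 hf hf0 (sM f) (fun P Q h => sM_mono f h) ?_ ?_ (cancelMax M f)
    (cancelMax_test f) (cancelMax_nonneg f) ?_ hB
  · intro P hP
    refine lt_of_lt_of_le ?_ (vM_le_sM f P)
    by_contra hc
    push Not at hc
    apply hP
    have h1 := abs_nonpos_iff.1 ((le_max_left _ _).trans hc)
    have h2 := abs_nonpos_iff.1 ((le_max_right _ _).trans hc)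
    have hL := P.len_pos
    rw [waveCoeff_eq hf.integrable]
    have h1' : ∫ x in P.left, f x = 0 := by
      field_simp at h1; linarith
    have h2' : ∫ x in P.right, f x = 0 := by
      field_simp at h2; linarith
    rw [h1', h2']; simp
  · intro Q L hL hQ F hF
    have h1 := energy_M hf hL Q ((vM_avg hf.integrable Q).trans ((vM_le_sM f Q).trans hQ))
    have h2 : ∑ P ∈ F, waveCoeff f P ^ 2
        ≤ ∑ P ∈ Q.sub, (if sM f P ≤ L then waveCoeff f P ^ 2 else 0) := by
      calc ∑ P ∈ F, waveCoeff f P ^ 2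
          = ∑ P ∈ F, (if sM f P ≤ L then waveCoeff f P ^ 2 else 0) :=
            Finset.sum_congr rfl fun P hP => by rw [if_pos (hF P hP).2]
        _ ≤ _ := by
            refine Finset.sum_le_sum_of_subset_of_nonneg ?_ ?_
            · intro P hP
              rw [Tile.mem_sub]
              exact (hF P hP).1
            · intro P _ _
              split_ifs <;> positivity
    have := mul_nonneg Q.len_pos.le (sq_nonneg (tileAvg f Q))
    nlinarith
  · intro Q hk l hl0 hl hR
    have hv : l < vM f Q := by
      by_contra hc
      push Not at hc
      refine absurd hl (not_lt.2 (Finset.sup'_le _ _ fun R hRa => ?_))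
      rw [Tile.mem_anc] at hRa
      by_cases e : Q = R
      · rw [← e]; exact hc
      · exact (vM_le_sM f R).trans (hR R hRa e)
    rcases lt_max_iff.1 hv with h | h
    · refine ⟨(Q.lc hk).ival, (Q.lc hk).meas, Q.lc_le hk, ?_, fun x hx => ?_⟩
      · rw [Tile.vol, Q.lc_len]; linarith
      · rw [← tileAvg_lc f Q hk] at h
        exact h.trans_le (le_cancelMax f hx)
    · refine ⟨(Q.rc hk).ival, (Q.rc hk).meas, Q.rc_le hk, ?_, fun x hx => ?_⟩
      · rw [Tile.vol, Q.rc_len]; linarith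
      · rw [← tileAvg_rc f Q hk] at h
        exact h.trans_le (le_cancelMax f hx)

/-- Theorem 5.4: atomic decomposition of dyadic `H^p`. -/
theorem statement9 (p : ℝ) (hp0 : 0 < p) (hp1 : p ≤ 1) :
    ∃ C : ℝ, 1 ≤ C ∧
      ∀ (M : ℕ) (f : ℝ → ℝ), IsTestFun M f → (∫ x, f x) = 0 →
        ∀ B : ℝ, 0 < B →
          (((∫ x, squareFn M f x ^ p) ≤ B ^ p →
              (∫ x, cancelMax M f x ^ p) ≤ (C * B) ^ p ∧ HasAtomicDecomp M p f (C * B)) ∧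
           ((∫ x, cancelMax M f x ^ p) ≤ B ^ p →
              (∫ x, squareFn M f x ^ p) ≤ (C * B) ^ p ∧ HasAtomicDecomp M p f (C * B)) ∧
           (HasAtomicDecomp M p f B →
              (∫ x, squareFn M f x ^ p) ≤ (C * B) ^ p ∧
              (∫ x, cancelMax M f x ^ p) ≤ (C * B) ^ p)) := by
  set K : ℝ := 2 * 2 ^ p * ((2:ℝ) ^ p / (2 ^ p - 1)) with hK
  have hq1 : 1 < (2:ℝ) ^ p := Real.one_lt_rpow (by norm_num) hp0
  have hK1 : 1 ≤ K := by
    have h1 : 1 ≤ (2:ℝ) ^ p / (2 ^ p - 1) := by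
      rw [le_div_iff₀ (by linarith)]; linarith
    rw [hK]; nlinarith
  have hroot : ∀ y B : ℝ, 0 ≤ y → 0 ≤ B → (y ^ (1 / p) * B) ^ p = y * B ^ p := by
    intro y B hy hB
    rw [Real.mul_rpow (Real.rpow_nonneg hy _) hB, ← Real.rpow_mul hy, one_div,
      inv_mul_cancel₀ hp0.ne', Real.rpow_one]
  refine ⟨(5 * K) ^ (1 / p), Real.one_le_rpow (by linarith) (by positivity), ?_⟩
  intro M f hf hf0 B hB
  have hBp : 0 < B ^ p := Real.rpow_pos_of_pos hB p
  have hmain := hroot (5 * K) B (by linarith) hB.le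
  have hKB := hroot K B (by linarith) hB.le
  have wk : ∀ {B' : ℝ}, HasAtomicDecomp M p f B' → B' ^ p ≤ ((5 * K) ^ (1 / p) * B) ^ p →
      HasAtomicDecomp M p f ((5 * K) ^ (1 / p) * B) := by
    rintro B' ⟨II, c, g, h1, h2, h3⟩ h
    exact ⟨II, c, g, h1, h2, h3.trans h⟩
  rw [hmain] at *
  refine ⟨fun h => ?_, fun h => ?_, fun h => ?_⟩
  · have hd : HasAtomicDecomp M p f (K ^ (1 / p) * B) :=
      decomp_S hp0 hf hf0 (by rw [hKB]; exact mul_le_mul_of_nonneg_left h (by linarith))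
    have := atoms_M hp0 hp1 hd
    rw [hKB] at this
    exact ⟨by linarith, wk hd (by rw [hKB]; nlinarith)⟩
  · have hd : HasAtomicDecomp M p f (K ^ (1 / p) * B) :=
      decomp_M hp0 hf hf0 (by rw [hKB]; exact mul_le_mul_of_nonneg_left h (by linarith))
    have := atoms_S hp0 hp1 hd
    rw [hKB] at this
    exact ⟨by linarith, wk hd (by rw [hKB]; nlinarith)⟩
  · have h1 := atoms_S hp0 hp1 h
    have h2 := atoms_M hp0 hp1 h
    constructor <;> nlinarith

end Dyadic
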